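/- Fix α ∈ (0,1), ν > 0, and positive integers n ≥ 2, k ≤ n, p, λ with m = pλ. Let v ∈ ℝ^λ be a nonzero row vector, γ = ‖v‖₁/‖v‖₂, V = I_p ⊗ v, and V̂ = (1/(‖v‖₂√p))·V. There exists a universal constant C₂ > 0 such that if m ≥ p ≥ C₂·k·(log⁴(n) + γ²ν)/α², then for Φ ∈ ℂ^{m×n} drawn from the sign-randomized bounded orthogonal ensemble, P( sup_{x∈T_k} | ‖V̂Φx‖₂² − ‖x‖₂² | ≤ α ) ≥ 1 − e^{−ν}. -/

import Mathlib

open scoped BigOperators Matrix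
noncomputable section

/-- The sign `±1` associated with a boolean. -/
def rsign (b : Bool) : ℝ := if b then 1 else -1

/-- `ℓ¹` norm of a real vector. -/
def norm1 {n : ℕ} (x : Fin n → ℝ) : ℝ := ∑ j, |x j|

/-- Euclidean norm of a real vector. -/
def norm2 {n : ℕ} (x : Fin n → ℝ) : ℝ := Real.sqrt (∑ j, (x j) ^ 2)

/-- Euclidean norm of a complex vector. -/
def norm2C {n : ℕ} (x : Fin n → ℂ) : ℝ := Real.sqrt (∑ j, ‖x j‖ ^ 2)

/-- `T_k`: complex unit-norm vectors with at most `k` nonzero entries. -/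
def Tk (n k : ℕ) : Set (Fin n → ℂ) :=
  {x | norm2C x = 1 ∧ ∃ s : Finset (Fin n), s.card ≤ k ∧ ∀ t ∉ s, x t = 0}

/-- Block-diagonal matrix `I_p ⊗ v` with `p` copies of the row vector `v` on the diagonal. -/
def kronRow (p : ℕ) {lam : ℕ} (v : Fin lam → ℝ) : Matrix (Fin p) (Fin (p * lam)) ℝ :=
  Matrix.of fun i j =>
    if (j : ℕ) / lam = (i : ℕ) then
      (if h2 : (j : ℕ) % lam < lam then v ⟨(j : ℕ) % lam, h2⟩ else 0)
    else 0

/-- Probability of an event under the uniform distribution on a finite sample space. -/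
def unifProb {Ω : Type*} [Fintype Ω] (P : Ω → Prop) : ℝ :=
  (Nat.card {ω : Ω // P ω} : ℝ) / (Fintype.card Ω : ℝ)

/-- The moment generating function of a Rademacher sum. -/
lemma sum_exp_rademacher_le {J : Type*} [Fintype J] [DecidableEq J] (c : J → ℝ) :
    ∑ δ : J → Bool, Real.exp (∑ j, rsign (δ j) * c j) ≤
      2 ^ Fintype.card J * Real.exp ((∑ j, c j ^ 2) / 2) := by
  have h : ∑ δ : J → Bool, Real.exp (∑ j, rsign (δ j) * c j) = ∏ j, (2 * Real.cosh (c j)) := by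
    simp_rw [Real.exp_sum]
    rw [← Fintype.prod_sum (fun j (b : Bool) => Real.exp (rsign b * c j))]
    refine Finset.prod_congr rfl fun j _ => ?_
    rw [Fintype.sum_bool, Real.cosh_eq]
    simp [rsign]
    ring
  rw [h, Finset.prod_mul_distrib, Finset.prod_const, Finset.card_univ, Finset.sum_div,
    Real.exp_sum]
  gcongr with j
  exact Real.cosh_le_exp_half_sq _

lemma integral_exp_shifted_sq (y : ℝ) :
    MeasureTheory.Integrable (fun x : ℝ => Real.exp (-x ^ 2 + 2 * x * y)) ∧
      ∫ x : ℝ, Real.exp (-x ^ 2 + 2 * x * y) = Real.exp (y ^ 2) * √Real.pi := by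
  have e : (fun x : ℝ => Real.exp (-x ^ 2 + 2 * x * y)) =
      fun x : ℝ => Real.exp (y ^ 2) * (fun z : ℝ => Real.exp (-1 * z ^ 2)) (x - y) := by
    ext x
    simp only
    rw [← Real.exp_add]
    ring_nf
  rw [e]
  constructor
  · exact ((integrable_exp_neg_mul_sq one_pos).comp_sub_right y).const_mul _
  · rw [MeasureTheory.integral_const_mul,
      MeasureTheory.integral_sub_right_eq_self (fun z : ℝ => Real.exp (-1 * z ^ 2)) y,
      integral_gaussian, div_one]

/-- Square-exponential integrability of normalized Rademacher sums. -/
lemma sum_exp_sq_rademacher_le {J : Type*} [Fintype J] [DecidableEq J] (c : J → ℝ) :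
    ∑ δ : J → Bool, Real.exp ((∑ j, rsign (δ j) * c j) ^ 2 / (4 * ∑ j, c j ^ 2)) ≤
      2 * 2 ^ Fintype.card J := by
  set s := ∑ j, c j ^ 2 with hs
  have hs0 : 0 ≤ s := Finset.sum_nonneg fun j _ => sq_nonneg _
  rcases hs0.eq_or_lt with h0 | hpos
  · rw [← h0]
    simp
  set X : (J → Bool) → ℝ := fun δ => ∑ j, rsign (δ j) * c j with hX
  have hsq : √s ^ 2 = s := Real.sq_sqrt hs0
  have hsp : 0 < √s := Real.sqrt_pos.2 hpos
  have hgauss := fun δ => integral_exp_shifted_sq (X δ / (2 * √s))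
  have hval : ∀ δ, Real.exp ((X δ) ^ 2 / (4 * s)) * √Real.pi =
      ∫ x : ℝ, Real.exp (-x ^ 2 + 2 * x * (X δ / (2 * √s))) := by
    intro δ
    rw [(hgauss δ).2, div_pow, mul_pow, hsq]
    norm_num
  have hle : (∑ δ, Real.exp ((X δ) ^ 2 / (4 * s))) * √Real.pi ≤
      2 ^ Fintype.card J * √(Real.pi / (1 / 2)) := by
    rw [Finset.sum_mul]
    simp_rw [hval]
    rw [← MeasureTheory.integral_finsetSum _ fun δ _ => (hgauss δ).1, ← integral_gaussian,
      ← MeasureTheory.integral_const_mul]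
    refine MeasureTheory.integral_mono (MeasureTheory.integrable_finsetSum _ fun δ _ => (hgauss δ).1)
      ((integrable_exp_neg_mul_sq (by norm_num)).const_mul _) fun x => ?_
    have h := sum_exp_rademacher_le (fun j => x / √s * c j)
    have e1 : ∀ δ : J → Bool, Real.exp (-x ^ 2 + 2 * x * (X δ / (2 * √s))) =
        Real.exp (-x ^ 2) * Real.exp (∑ j, rsign (δ j) * (x / √s * c j)) := by
      intro δ
      rw [← Real.exp_add, hX]
      congr 2
      simp only
      rw [Finset.sum_div, Finset.mul_sum]
      refine Finset.sum_congr rfl fun j _ => ?_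
      field_simp
    have e2 : ∑ j, (x / √s * c j) ^ 2 = x ^ 2 := by
      simp_rw [mul_pow]
      rw [← Finset.mul_sum, ← hs, div_pow, hsq]
      field_simp
    simp only [e1]
    rw [← Finset.mul_sum]
    rw [e2] at h
    calc _ ≤ Real.exp (-x ^ 2) * (2 ^ Fintype.card J * Real.exp (x ^ 2 / 2)) := by gcongr
      _ = 2 ^ Fintype.card J * (Real.exp (-x ^ 2) * Real.exp (x ^ 2 / 2)) := by ring
      _ = _ := by
        rw [← Real.exp_add]
        ring_nf
  have hpi : 0 < √Real.pi := Real.sqrt_pos.2 Real.pi_pos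
  have h2 : √(Real.pi / (1 / 2)) ≤ 2 * √Real.pi := by
    rw [Real.sqrt_le_left (by positivity), mul_pow, Real.sq_sqrt Real.pi_pos.le]
    linarith [Real.pi_pos]
  refine le_of_mul_le_mul_right (hle.trans ?_) hpi
  calc _ ≤ 2 ^ Fintype.card J * (2 * √Real.pi) := by gcongr
    _ = _ := by ring

/-- The coordinate `b` of `a Φ x`, where the `j`-th row of `Φ` is the functional `f (ω j)`. -/
def sketch {J E β X : Type*} [Fintype J] [AddCommGroup X] [Module ℂ X]
    (a : β → J → ℝ) (f : E → X →ₗ[ℂ] ℂ) (ω : J → E) (x : X) (b : β) : ℂ :=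
  ∑ j, (a b j : ℂ) * f (ω j) x

/-- The squared Euclidean norm of `a Φ x`. -/
def energy {J E β X : Type*} [Fintype J] [Fintype β] [AddCommGroup X] [Module ℂ X]
    (a : β → J → ℝ) (f : E → X →ₗ[ℂ] ℂ) (ω : J → E) (x : X) : ℝ :=
  ∑ b, ‖sketch a f ω x b‖ ^ 2

/-- The `j`-th summand of the polarized difference of the energies of two samples. -/
def polarCoef {J E β X : Type*} [Fintype J] [Fintype β] [AddCommGroup X] [Module ℂ X]
    (a : β → J → ℝ) (f : E → X →ₗ[ℂ] ℂ) (w : (J → E) × (J → E)) (x y : X) (j : J) : ℝ :=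
  (starRingEnd ℂ (f (w.1 j) x - f (w.2 j) x) *
    ∑ b, (a b j : ℂ) * (sketch a f w.1 y b + sketch a f w.2 y b)).re

/-- The polarized difference of the energies of two samples. -/
def polar {J E β X : Type*} [Fintype J] [Fintype β] [AddCommGroup X] [Module ℂ X]
    (a : β → J → ℝ) (f : E → X →ₗ[ℂ] ℂ) (w : (J → E) × (J → E)) (x y : X) : ℝ :=
  ∑ j, polarCoef a f w x y j

/-- Exchange the two samples at the indices where `δ` is false. -/
def exchange {J E : Type*} (δ : J → Bool) (w : (J → E) × (J → E)) : (J → E) × (J → E) :=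
  (fun j => if δ j then w.1 j else w.2 j, fun j => if δ j then w.2 j else w.1 j)

lemma exchange_involutive {J E : Type*} (δ : J → Bool) :
    Function.Involutive (exchange (E := E) δ) := by
  intro w
  ext j <;> by_cases h : δ j <;> simp [exchange, h]

section Polar

variable {J E β X : Type*} [Fintype J] [AddCommGroup X] [Module ℂ X]
  (a : β → J → ℝ) (f : E → X →ₗ[ℂ] ℂ)

lemma sketch_sub (ω : J → E) (x y : X) (b : β) :
    sketch a f ω (x - y) b = sketch a f ω x b - sketch a f ω y b := by
  simp [sketch, mul_sub, Finset.sum_sub_distrib]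

variable {f} in
lemma sketch_neg {neg : E → E} (hneg : ∀ e x, f (neg e) x = -f e x) (ω : J → E) (x : X) (b : β) :
    sketch a f (neg ∘ ω) x b = -sketch a f ω x b := by
  simp [sketch, hneg]

variable [Fintype β]

lemma energy_zero (ω : J → E) : energy a f ω 0 = 0 := by
  simp [energy, sketch]

lemma energy_nonneg (ω : J → E) (x : X) : 0 ≤ energy a f ω x :=
  Finset.sum_nonneg fun _ _ => sq_nonneg _

lemma polar_eq (w : (J → E) × (J → E)) (x y : X) :
    polar a f w x y = ∑ b, (starRingEnd ℂ (sketch a f w.1 x b - sketch a f w.2 x b) *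
      (sketch a f w.1 y b + sketch a f w.2 y b)).re := by
  simp only [polar, polarCoef]
  rw [← Complex.re_sum, ← Complex.re_sum]
  congr 1
  simp_rw [Finset.mul_sum]
  rw [Finset.sum_comm]
  refine Finset.sum_congr rfl fun b _ => ?_
  rw [sketch.eq_def a f w.1 x, sketch.eq_def a f w.2 x, ← Finset.sum_sub_distrib, map_sum,
    Finset.sum_mul]
  refine Finset.sum_congr rfl fun j _ => ?_
  simp only [map_sub, map_mul, Complex.conj_ofReal]
  ring

lemma polar_self (w : (J → E) × (J → E)) (x : X) :
    polar a f w x x = energy a f w.1 x - energy a f w.2 x := by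
  rw [polar_eq, energy, energy, ← Finset.sum_sub_distrib]
  refine Finset.sum_congr rfl fun b _ => ?_
  rw [← Complex.normSq_eq_norm_sq, ← Complex.normSq_eq_norm_sq, Complex.normSq_apply,
    Complex.normSq_apply]
  simp
  ring

lemma polar_sub_left (w : (J → E) × (J → E)) (x y z : X) :
    polar a f w (x - y) z = polar a f w x z - polar a f w y z := by
  simp only [polar_eq, sketch_sub]
  rw [← Finset.sum_sub_distrib]
  refine Finset.sum_congr rfl fun b _ => ?_
  rw [← Complex.sub_re, ← sub_mul, ← map_sub]
  congr 3
  ring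

lemma polar_sub_right (w : (J → E) × (J → E)) (x y z : X) :
    polar a f w z (x - y) = polar a f w z x - polar a f w z y := by
  simp only [polar_eq, sketch_sub]
  rw [← Finset.sum_sub_distrib]
  refine Finset.sum_congr rfl fun b _ => ?_
  rw [← Complex.sub_re, ← mul_sub]
  congr 2
  ring

lemma polar_zero (w : (J → E) × (J → E)) : polar a f w 0 0 = 0 := by
  rw [polar_self, energy_zero, energy_zero, sub_zero]

variable {f} in
lemma energy_neg {neg : E → E} (hneg : ∀ e x, f (neg e) x = -f e x) (ω : J → E) (x : X) :
    energy a f (neg ∘ ω) x = energy a f ω x := by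
  simp [energy, sketch_neg a hneg]

variable {f} in
lemma polar_neg {neg : E → E} (hneg : ∀ e x, f (neg e) x = -f e x) (w : (J → E) × (J → E))
    (x y : X) : polar a f (w.1, neg ∘ w.2) x y = polar a f w y x := by
  simp only [polar_eq, sketch_neg a hneg]
  refine Finset.sum_congr rfl fun b _ => ?_
  simp
  ring

lemma polarCoef_exchange (δ : J → Bool) (w : (J → E) × (J → E)) (x y : X) (j : J) :
    polarCoef a f (exchange δ w) x y j = rsign (δ j) * polarCoef a f w x y j := by
  have h : ∀ b, sketch a f (exchange δ w).1 y b + sketch a f (exchange δ w).2 y b =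
      sketch a f w.1 y b + sketch a f w.2 y b := by
    intro b
    simp only [sketch]
    rw [← Finset.sum_add_distrib, ← Finset.sum_add_distrib]
    refine Finset.sum_congr rfl fun i _ => ?_
    by_cases h : δ i <;> simp [exchange, h]
    ring
  simp only [polarCoef, h]
  by_cases h : δ j
  · simp [exchange, h, rsign]
  · simp [exchange, h, rsign]
    ring

lemma expect_exp_polar_le [DecidableEq J] [Fintype E] [Nonempty E] (x y : X) :
    (𝔼 w : (J → E) × (J → E),
      Real.exp (polar a f w x y ^ 2 / (4 * ∑ j, polarCoef a f w x y j ^ 2))) ≤ 2 := by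
  set g : (J → E) × (J → E) → ℝ := fun w =>
    Real.exp (polar a f w x y ^ 2 / (4 * ∑ j, polarCoef a f w x y j ^ 2)) with hg
  have hinv : ∀ δ : J → Bool, (𝔼 w, g (exchange δ w)) = 𝔼 w, g w := fun δ =>
    Fintype.expect_equiv (exchange_involutive δ).toPerm _ _ fun _ => rfl
  have h1 : (𝔼 w, g w) = 𝔼 w, 𝔼 δ : J → Bool, g (exchange δ w) := by
    rw [Finset.expect_comm]
    simp_rw [hinv]
    rw [Fintype.expect_const]
  rw [h1]
  refine Finset.expect_le Finset.univ_nonempty fun w _ => ?_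
  rw [Fintype.expect_eq_sum_div_card, div_le_iff₀ (by positivity)]
  have h := sum_exp_sq_rademacher_le (polarCoef a f w x y)
  simp only [hg, polar, polarCoef_exchange, mul_pow]
  have hr : ∀ b, rsign b ^ 2 = 1 := by intro b; cases b <;> simp [rsign]
  simpa [hr] using h

lemma sum_polarCoef_sq_le {ρ : ℝ}
    (hρ : ∀ S : β → ℂ, ∑ j, ‖∑ b, (a b j : ℂ) * S b‖ ^ 2 ≤ ρ * ∑ b, ‖S b‖ ^ 2) (hρ0 : 0 ≤ ρ)
    (w : (J → E) × (J → E)) (x y : X) {t : ℝ} (ht : ∀ e, ‖f e x‖ ≤ t) :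
    ∑ j, polarCoef a f w x y j ^ 2 ≤
      8 * t ^ 2 * ρ * (energy a f w.1 y + energy a f w.2 y) := by
  set S : β → ℂ := fun b => sketch a f w.1 y b + sketch a f w.2 y b with hS
  have h1 : ∀ j, polarCoef a f w x y j ^ 2 ≤ (2 * t) ^ 2 * ‖∑ b, (a b j : ℂ) * S b‖ ^ 2 := by
    intro j
    rw [← mul_pow, ← sq_abs]
    gcongr
    refine (Complex.abs_re_le_norm _).trans ?_
    rw [norm_mul, RCLike.norm_conj]
    gcongr
    refine (norm_sub_le _ _).trans ?_
    linarith [ht (w.1 j), ht (w.2 j)]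
  have h2 : ∑ b, ‖S b‖ ^ 2 ≤ 2 * (energy a f w.1 y + energy a f w.2 y) := by
    rw [energy, energy, ← Finset.sum_add_distrib, Finset.mul_sum]
    refine Finset.sum_le_sum fun b _ => ?_
    have := norm_add_le (sketch a f w.1 y b) (sketch a f w.2 y b)
    have h0 := norm_nonneg (sketch a f w.1 y b + sketch a f w.2 y b)
    nlinarith [sq_nonneg (‖sketch a f w.1 y b‖ - ‖sketch a f w.2 y b‖)]
  calc _ ≤ ∑ j, (2 * t) ^ 2 * ‖∑ b, (a b j : ℂ) * S b‖ ^ 2 := Finset.sum_le_sum fun j _ => h1 j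
    _ = (2 * t) ^ 2 * ∑ j, ‖∑ b, (a b j : ℂ) * S b‖ ^ 2 := by rw [Finset.mul_sum]
    _ ≤ (2 * t) ^ 2 * (ρ * (2 * (energy a f w.1 y + energy a f w.2 y))) := by
      gcongr
      exact (hρ S).trans (by gcongr)
    _ = _ := by ring

/-- A single random variable of bounded expectation controls the polarized energies of a
weighted family of pairs simultaneously. -/
lemma exists_polar_sq_le [DecidableEq J] [Fintype E] [Nonempty E] {ρ : ℝ}
    (hρ : ∀ S : β → ℂ, ∑ j, ‖∑ b, (a b j : ℂ) * S b‖ ^ 2 ≤ ρ * ∑ b, ‖S b‖ ^ 2) (hρ0 : 0 ≤ ρ)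
    {ι : Type*} (T : Finset ι) (u y : ι → X) (L t : ι → ℝ) (hL0 : ∀ i ∈ T, 0 ≤ L i)
    (hL : ∑ i ∈ T, Real.exp (-L i) ≤ 1) (ht : ∀ i ∈ T, ∀ e, ‖f e (u i)‖ ≤ t i) :
    ∃ Q : (J → E) × (J → E) → ℝ, (∀ w, 0 ≤ Q w) ∧ (𝔼 w, Q w) ≤ 2 ∧
      ∀ w, ∀ i ∈ T, polar a f w (u i) (y i) ^ 2 ≤
        32 * t i ^ 2 * ρ * (energy a f w.1 (y i) + energy a f w.2 (y i)) *
          (L i + Real.log (1 + Q w)) := by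
  set g : ι → (J → E) × (J → E) → ℝ := fun i w =>
    Real.exp (polar a f w (u i) (y i) ^ 2 / (4 * ∑ j, polarCoef a f w (u i) (y i) j ^ 2)) with hg
  have hQ0 : ∀ w, 0 ≤ ∑ i ∈ T, Real.exp (-L i) * g i w := fun w =>
    Finset.sum_nonneg fun i _ => by positivity
  refine ⟨fun w => ∑ i ∈ T, Real.exp (-L i) * g i w, hQ0, ?_, ?_⟩
  · rw [Finset.expect_sum_comm]
    calc _ ≤ ∑ i ∈ T, Real.exp (-L i) * 2 := by
          refine Finset.sum_le_sum fun i _ => ?_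
          rw [← Finset.mul_expect]
          gcongr
          exact expect_exp_polar_le a f _ _
      _ ≤ 2 := by rw [← Finset.sum_mul]; linarith
  · intro w i hi
    set s := ∑ j, polarCoef a f w (u i) (y i) j ^ 2 with hs
    have hs0 : 0 ≤ s := Finset.sum_nonneg fun j _ => sq_nonneg _
    set Q := ∑ i ∈ T, Real.exp (-L i) * g i w with hQ
    have hlog : 0 ≤ Real.log (1 + Q) := Real.log_nonneg (by linarith [hQ0 w])
    have key : polar a f w (u i) (y i) ^ 2 ≤ 4 * s * (L i + Real.log (1 + Q)) := by
      rcases hs0.eq_or_lt with h0 | hpos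
      · have hz : ∀ j, polarCoef a f w (u i) (y i) j = 0 := by
          intro j
          have := (Finset.sum_eq_zero_iff_of_nonneg
            (fun j _ => sq_nonneg (polarCoef a f w (u i) (y i) j))).1 (hs.symm.trans h0.symm) j
            (Finset.mem_univ j)
          exact pow_eq_zero_iff (two_ne_zero) |>.1 this
        rw [polar, Finset.sum_eq_zero fun j _ => hz j, ← h0]
        simp
      · have h1 : Real.exp (-L i) * g i w ≤ 1 + Q := by
          have := Finset.single_le_sum (f := fun i => Real.exp (-L i) * g i w)
            (fun i _ => by positivity) hi
          linarith
        have h2 := Real.log_le_log (by positivity) h1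
        rw [Real.log_mul (by positivity) (by positivity), Real.log_exp, hg, Real.log_exp] at h2
        have h3 : polar a f w (u i) (y i) ^ 2 / (4 * s) ≤ L i + Real.log (1 + Q) := by linarith
        rw [div_le_iff₀ (by positivity)] at h3
        linarith
    refine key.trans ?_
    have := sum_polarCoef_sq_le a f hρ hρ0 w (u i) (y i) (ht i hi)
    have h4 := hL0 i hi
    calc _ ≤ 4 * (8 * t i ^ 2 * ρ * (energy a f w.1 (y i) + energy a f w.2 (y i))) *
          (L i + Real.log (1 + Q)) := by gcongr
      _ = _ := by ring

end Polar

/-- Chaining for the difference of the energies of two independent samples. -/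
lemma exists_energy_sub_le {J E β X : Type*} [Fintype J] [DecidableEq J] [Fintype E] [Nonempty E]
    [Fintype β] [AddCommGroup X] [Module ℂ X] [DecidableEq X]
    (a : β → J → ℝ) (f : E → X →ₗ[ℂ] ℂ) {neg : E → E} (hinv : Function.Involutive neg)
    (hneg : ∀ e x, f (neg e) x = -f e x) {ρ : ℝ}
    (hρ : ∀ S : β → ℂ, ∑ j, ‖∑ b, (a b j : ℂ) * S b‖ ^ 2 ≤ ρ * ∑ b, ‖S b‖ ^ 2) (hρ0 : 0 ≤ ρ)
    (N : Finset X) (R : ℕ) (π : ℕ → X → X) (η L : ℕ → ℝ) (Γ d : ℝ)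
    (hπ0 : ∀ x ∈ N, π 0 x = 0) (hπR : ∀ x ∈ N, π (R + 1) x = x)
    (hπ : ∀ r, ∀ x ∈ N, π r x ∈ insert 0 N)
    (hη0 : ∀ r, 0 ≤ η r) (hL0 : ∀ r, 0 ≤ L r)
    (hη : ∀ r < R + 1, ∀ x ∈ N, ∀ e, ‖f e (π (r + 1) x - π r x)‖ ≤ η r)
    (hcard : ∀ r < R + 1,
      (R + 1 : ℝ) * ((N.image fun x => (π r x, π (r + 1) x)).card : ℝ) ≤ Real.exp (L r))
    (hΓ : ∑ r ∈ Finset.range (R + 1), η r * √(L r) ≤ Γ)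
    (hd : ∑ r ∈ Finset.range (R + 1), η r ≤ d) :
    ∃ Q : (J → E) × (J → E) → ℝ, (∀ w, 0 ≤ Q w) ∧ (𝔼 w, Q w) ≤ 4 ∧
      ∀ w, ∀ S : ℝ, 0 ≤ S → (∀ y ∈ N, energy a f w.1 y + energy a f w.2 y ≤ S) →
        ∀ x ∈ N, |energy a f w.1 x - energy a f w.2 x| ≤
          2 * √(32 * ρ * S) * (Γ + d * √(Real.log (1 + Q w))) := by
  set T : Finset (Σ _ : ℕ, X × X) :=
    (Finset.range (R + 1)).sigma fun r => N.image fun x => (π r x, π (r + 1) x) with hT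
  have hL : ∑ i ∈ T, Real.exp (-L i.1) ≤ 1 := by
    rw [hT, Finset.sum_sigma]
    calc _ ≤ ∑ r ∈ Finset.range (R + 1), (1 / (R + 1 : ℝ)) := by
          refine Finset.sum_le_sum fun r hr => ?_
          have := hcard r (Finset.mem_range.1 hr)
          simp only [Finset.sum_const, nsmul_eq_mul, Real.exp_neg]
          rw [le_div_iff₀ (by positivity), ← div_eq_mul_inv, div_mul_eq_mul_div,
            div_le_one (Real.exp_pos _)]
          linarith
      _ = 1 := by
          simp
          field_simp
  have ht : ∀ i ∈ T, ∀ e, ‖f e (i.2.2 - i.2.1)‖ ≤ η i.1 := by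
    rintro ⟨r, z⟩ hi e
    simp only [hT, Finset.mem_sigma, Finset.mem_range, Finset.mem_image] at hi
    obtain ⟨hr, x, hx, rfl⟩ := hi
    exact hη r hr x hx e
  obtain ⟨Q₁, hQ₁, hE₁, hB₁⟩ := exists_polar_sq_le a f hρ hρ0 T (fun i => i.2.2 - i.2.1)
    (fun i => i.2.2) (fun i => L i.1) (fun i => η i.1) (fun i _ => hL0 _) hL ht
  obtain ⟨Q₂, hQ₂, hE₂, hB₂⟩ := exists_polar_sq_le a f hρ hρ0 T (fun i => i.2.2 - i.2.1)
    (fun i => i.2.1) (fun i => L i.1) (fun i => η i.1) (fun i _ => hL0 _) hL ht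
  have hE₂' : (𝔼 w : (J → E) × (J → E), Q₂ (w.1, neg ∘ w.2)) = 𝔼 w, Q₂ w := by
    have hi : Function.Involutive
        (fun w : (J → E) × (J → E) => ((w.1, neg ∘ w.2) : (J → E) × (J → E))) := by
      intro w
      ext j <;> simp [hinv _]
    exact Fintype.expect_equiv hi.toPerm _ _ fun _ => rfl
  refine ⟨fun w => Q₁ w + Q₂ (w.1, neg ∘ w.2), fun w => add_nonneg (hQ₁ _) (hQ₂ _), ?_, ?_⟩
  · rw [Finset.expect_add_distrib, hE₂']
    linarith
  intro w S hS0 hS x hx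
  set q := Real.log (1 + (Q₁ w + Q₂ (w.1, neg ∘ w.2))) with hq
  have hq₁ : Real.log (1 + Q₁ w) ≤ q :=
    Real.log_le_log (by linarith [hQ₁ w]) (by linarith [hQ₂ (w.1, neg ∘ w.2)])
  have hq₂ : Real.log (1 + Q₂ (w.1, neg ∘ w.2)) ≤ q :=
    Real.log_le_log (by linarith [hQ₂ (w.1, neg ∘ w.2)]) (by linarith [hQ₁ w])
  have hS' : ∀ r, energy a f w.1 (π r x) + energy a f w.2 (π r x) ≤ S := by
    intro r
    rcases Finset.mem_insert.1 (hπ r x hx) with h | h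
    · rw [h, energy_zero, energy_zero]
      simpa using hS0
    · exact hS _ h
  have hen : ∀ y, 0 ≤ energy a f w.1 y + energy a f w.2 y := fun y =>
    add_nonneg (energy_nonneg a f _ _) (energy_nonneg a f _ _)
  have hq0 : 0 ≤ q := Real.log_nonneg (by linarith [hQ₁ w, hQ₂ (w.1, neg ∘ w.2)])
  have hsqrt : ∀ r (z : ℝ), z ^ 2 ≤ 32 * η r ^ 2 * ρ * S * (L r + q) →
      |z| ≤ √(32 * ρ * S) * (η r * √(L r) + η r * √q) := by
    intro r z hz
    have h1 : √(L r + q) ≤ √(L r) + √q := by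
      rw [Real.sqrt_le_left (by positivity), add_sq, Real.sq_sqrt (hL0 r), Real.sq_sqrt hq0]
      have : 0 ≤ 2 * √(L r) * √q := by positivity
      linarith
    rw [← mul_add]
    calc |z| ≤ √(32 * ρ * S) * (η r * √(L r + q)) := by
          refine abs_le_of_sq_le_sq ?_ (by have := hη0 r; positivity)
          rw [mul_pow, mul_pow, Real.sq_sqrt (by positivity),
            Real.sq_sqrt (add_nonneg (hL0 r) hq0)]
          linarith
      _ ≤ _ := by
          have := hη0 r
          gcongr
  have hstep : ∀ r < R + 1,
      |polar a f w (π (r + 1) x) (π (r + 1) x) - polar a f w (π r x) (π r x)| ≤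
        2 * √(32 * ρ * S) * (η r * √(L r) + η r * √q) := by
    intro r hr
    have hmem : (⟨r, (π r x, π (r + 1) x)⟩ : Σ _ : ℕ, X × X) ∈ T := by
      simp only [hT, Finset.mem_sigma, Finset.mem_range, Finset.mem_image]
      exact ⟨hr, x, hx, rfl⟩
    have b₁ := hsqrt r _ ((hB₁ w _ hmem).trans (by
      simp only
      have h1 := hS' (r + 1)
      have h2 := hL0 r
      have h3 : 0 ≤ L r + Real.log (1 + Q₁ w) :=
        add_nonneg h2 (Real.log_nonneg (by linarith [hQ₁ w]))
      gcongr))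
    have b₂' := hB₂ (w.1, neg ∘ w.2) _ hmem
    simp only [polar_neg a hneg, energy_neg a hneg] at b₂'
    have b₂ := hsqrt r _ (b₂'.trans (by
      have h1 := hS' r
      have h2 := hL0 r
      have h3 : 0 ≤ L r + Real.log (1 + Q₂ (w.1, neg ∘ w.2)) :=
        add_nonneg h2 (Real.log_nonneg (by linarith [hQ₂ (w.1, neg ∘ w.2)]))
      gcongr))
    have e : polar a f w (π (r + 1) x) (π (r + 1) x) - polar a f w (π r x) (π r x) =
        polar a f w (π (r + 1) x - π r x) (π (r + 1) x) +
          polar a f w (π r x) (π (r + 1) x - π r x) := by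
      rw [polar_sub_left, polar_sub_right]
      ring
    rw [e]
    refine (abs_add_le _ _).trans ?_
    linarith
  have htel : energy a f w.1 x - energy a f w.2 x = ∑ r ∈ Finset.range (R + 1),
      (polar a f w (π (r + 1) x) (π (r + 1) x) - polar a f w (π r x) (π r x)) := by
    rw [Finset.sum_range_sub (fun r => polar a f w (π r x) (π r x)), hπ0 x hx, hπR x hx,
      polar_zero, sub_zero, polar_self]
  rw [htel]
  calc _ ≤ ∑ r ∈ Finset.range (R + 1), 2 * √(32 * ρ * S) * (η r * √(L r) + η r * √q) :=
        (Finset.abs_sum_le_sum_abs _ _).trans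
          (Finset.sum_le_sum fun r hr => hstep r (Finset.mem_range.1 hr))
    _ = 2 * √(32 * ρ * S) * (∑ r ∈ Finset.range (R + 1), η r * √(L r) +
          (∑ r ∈ Finset.range (R + 1), η r) * √q) := by
        rw [← Finset.mul_sum, Finset.sum_add_distrib, Finset.sum_mul]
    _ ≤ _ := by gcongr

lemma unifProb_eq_expect {Ω : Type*} [Fintype Ω] (P : Ω → Prop) [DecidablePred P] :
    unifProb P = 𝔼 ω, if P ω then (1 : ℝ) else 0 := by
  rw [Fintype.expect_eq_sum_div_card, unifProb, Nat.card_eq_fintype_card, Fintype.card_subtype,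
    Finset.sum_boole]

/-- Markov's inequality on a finite uniform space. -/
lemma expect_ite_le {Ω : Type*} [Fintype Ω] (Q : Ω → ℝ) (hQ : ∀ ω, 0 ≤ Q ω) (P : Ω → Prop)
    [DecidablePred P] {t : ℝ} (ht : 0 < t) (hP : ∀ ω, P ω → t ≤ Q ω) :
    (𝔼 ω, if P ω then (1 : ℝ) else 0) ≤ (𝔼 ω, Q ω) / t := by
  rw [le_div_iff₀ ht, Finset.expect_mul]
  refine Finset.expect_le_expect fun ω _ => ?_
  split_ifs with h
  · simpa using hP ω h
  · simpa using hQ ω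

/-- Symmetrization with a self-bounding increment: the deviation `Z` is small with high
probability as soon as the difference process of two independent copies is controlled. -/
lemma expect_ite_gt_le_exp {Ω : Type*} [Fintype Ω] [Nonempty Ω] (Z : Ω → ℝ) (D Q : Ω × Ω → ℝ)
    {α ν g h : ℝ} (hα : 0 < α) (hα1 : α < 1) (hν : 0 < ν) (hh : 0 ≤ h)
    (hZ : ∀ ω, 0 ≤ Z ω) (hQ : ∀ w, 0 ≤ Q w) (hEQ : (𝔼 w, Q w) ≤ 4)
    (hZD : ∀ ω, Z ω ≤ 𝔼 ω', D (ω, ω')) (hsub : ∀ ω ω', Z ω - Z ω' ≤ D (ω, ω'))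
    (hD : ∀ w, D w ≤ α / 16 * (2 + Z w.1 + Z w.2) + (g + h * Real.log (1 + Q w)) / (α / 16))
    (hg : g ≤ α ^ 2 / 2000) (hh' : h * (4 + ν) ≤ α ^ 2 / 2000) :
    (𝔼 ω, if α < Z ω then (1 : ℝ) else 0) ≤ Real.exp (-ν) := by
  have hprod : ∀ F : Ω × Ω → ℝ, (𝔼 w, F w) = 𝔼 ω, 𝔼 ω', F (ω, ω') := fun F => by
    rw [← Finset.univ_product_univ, Finset.expect_product]
  have hlog : (𝔼 w, Real.log (1 + Q w)) ≤ 4 :=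
    (Finset.expect_le_expect fun w _ => by
      linarith [Real.log_le_sub_one_of_pos (show 0 < 1 + Q w by linarith [hQ w])]).trans hEQ
  have hαα : α ^ 2 / 2000 / (α / 16) = α / 125 := by
    field_simp
    norm_num
  set z := 𝔼 ω, Z ω with hz
  have hz0 : 0 ≤ z := Finset.expect_nonneg fun ω _ => hZ ω
  have hEZ : z ≤ α / 4 := by
    have h1 : z ≤ 𝔼 w, D w := by
      rw [hprod]
      exact Finset.expect_le_expect fun ω _ => hZD ω
    have h2 : (𝔼 w, D w) ≤ α / 16 * (2 + z + z) +
        (g + h * 𝔼 w, Real.log (1 + Q w)) / (α / 16) := by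
      refine (Finset.expect_le_expect fun w _ => hD w).trans_eq ?_
      have e1 : (𝔼 w : Ω × Ω, Z w.1) = z := by
        rw [hprod]
        simp only [Fintype.expect_const, hz]
      have e2 : (𝔼 w : Ω × Ω, Z w.2) = z := by
        rw [hprod]
        simp only [Fintype.expect_const, hz]
      rw [Finset.expect_add_distrib, ← Finset.mul_expect, Finset.expect_add_distrib,
        Finset.expect_add_distrib, ← Finset.expect_div, Finset.expect_add_distrib,
        ← Finset.mul_expect, e1, e2, Fintype.expect_const, Fintype.expect_const]
    have h3 : (g + h * 𝔼 w, Real.log (1 + Q w)) / (α / 16) ≤ 2 * (α / 125) := by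
      rw [← hαα, ← mul_div_assoc]
      gcongr
      have : h * (𝔼 w, Real.log (1 + Q w)) ≤ h * (4 + ν) := by gcongr; linarith
      linarith
    nlinarith [mul_nonneg hα.le hz0]
  have hmed : 1 / 2 ≤ 𝔼 ω, if Z ω ≤ α / 2 then (1 : ℝ) else 0 := by
    have h1 : (𝔼 ω, if α / 2 < Z ω then (1 : ℝ) else 0) ≤ 1 / 2 := by
      refine (expect_ite_le Z hZ _ (half_pos hα) fun ω h => h.le).trans ?_
      rw [div_le_iff₀ (by positivity)]
      linarith
    have h2 : (𝔼 ω, if Z ω ≤ α / 2 then (1 : ℝ) else 0) +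
        (𝔼 ω, if α / 2 < Z ω then (1 : ℝ) else 0) = 1 := by
      rw [← Finset.expect_add_distrib]
      calc _ = 𝔼 _ω : Ω, (1 : ℝ) := by
            refine Finset.expect_congr rfl fun ω _ => ?_
            by_cases h : Z ω ≤ α / 2
            · simp [h, not_lt.2 h]
            · simp [h, not_le.1 h]
        _ = 1 := Fintype.expect_const _
    linarith
  have hjoint : (𝔼 ω, if α < Z ω then (1 : ℝ) else 0) * (𝔼 ω, if Z ω ≤ α / 2 then (1 : ℝ) else 0)
      = 𝔼 w : Ω × Ω, if α < Z w.1 ∧ Z w.2 ≤ α / 2 then (1 : ℝ) else 0 := by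
    rw [hprod, Finset.expect_mul]
    refine Finset.expect_congr rfl fun ω _ => ?_
    rw [Finset.mul_expect]
    refine Finset.expect_congr rfl fun ω' _ => ?_
    by_cases h1 : α < Z ω <;> by_cases h2 : Z ω' ≤ α / 2 <;> simp [h1, h2]
  have htail : (𝔼 w : Ω × Ω, if α < Z w.1 ∧ Z w.2 ≤ α / 2 then (1 : ℝ) else 0) ≤
      5 / (10 * Real.exp ν) := by
    refine (expect_ite_le (fun w => 1 + Q w) (fun w => by linarith [hQ w]) _
      (t := 10 * Real.exp ν) (by positivity) ?_).trans ?_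
    · rintro ⟨ω, ω'⟩ ⟨h1, h2⟩
      by_contra! hlt
      simp only at h1 h2 hlt
      have hl : Real.log (1 + Q (ω, ω')) ≤ 4 + ν := by
        have h10 : Real.log 10 ≤ 4 := by
          rw [Real.log_le_iff_le_exp (by norm_num)]
          have : (2 : ℝ) ≤ Real.exp 1 := by linarith [Real.add_one_le_exp (1 : ℝ)]
          calc (10 : ℝ) ≤ 2 ^ 4 := by norm_num
            _ ≤ Real.exp 1 ^ 4 := by gcongr
            _ = Real.exp 4 := by rw [← Real.exp_nat_mul]; norm_num
        have := Real.log_le_log (by linarith [hQ (ω, ω')]) hlt.le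
        rw [Real.log_mul (by norm_num) (by positivity), Real.log_exp] at this
        linarith
      have h3 : (g + h * Real.log (1 + Q (ω, ω'))) / (α / 16) ≤ 2 * (α / 125) := by
        rw [← hαα, ← mul_div_assoc]
        gcongr
        have : h * Real.log (1 + Q (ω, ω')) ≤ h * (4 + ν) := by gcongr
        linarith
      have h4 := (hsub ω ω').trans (hD (ω, ω'))
      simp only at h4
      nlinarith [hZ ω', mul_pos hα hα]
    · rw [Finset.expect_add_distrib, Fintype.expect_const]
      gcongr
      linarith
  have hnn : 0 ≤ 𝔼 ω, if α < Z ω then (1 : ℝ) else 0 :=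
    Finset.expect_nonneg fun ω _ => by split_ifs <;> norm_num
  rw [← hjoint] at htail
  have : (5 : ℝ) / (10 * Real.exp ν) = Real.exp (-ν) / 2 := by
    rw [Real.exp_neg]
    field_simp
    norm_num
  nlinarith

lemma expect_apply {J E : Type*} [Fintype J] [DecidableEq J] [Fintype E] [Nonempty E]
    (g : E → ℝ) (j : J) : (𝔼 ω : J → E, g (ω j)) = 𝔼 e, g e := by
  rw [Fintype.expect_equiv (Equiv.funSplitAt j E) (fun ω : J → E => g (ω j)) (fun z => g z.1)
    (fun ω => rfl), ← Finset.univ_product_univ, Finset.expect_product]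
  simp only [Fintype.expect_const]

/-- The expected energy under independent symmetric sampling. -/
lemma expect_energy {J E β X : Type*} [Fintype J] [DecidableEq J] [Fintype E] [Nonempty E]
    [Fintype β] [AddCommGroup X] [Module ℂ X] (a : β → J → ℝ) (f : E → X →ₗ[ℂ] ℂ) {neg : E → E}
    (hinv : Function.Involutive neg) (hneg : ∀ e x, f (neg e) x = -f e x) (x : X) :
    (𝔼 ω : J → E, energy a f ω x) = (∑ b, ∑ j, a b j ^ 2) * 𝔼 e, ‖f e x‖ ^ 2 := by
  have hexp : ∀ ω : J → E, energy a f ω x = ∑ b, ∑ i, ∑ j, a b i * a b j *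
      (starRingEnd ℂ (f (ω i) x) * f (ω j) x).re := by
    intro ω
    refine Finset.sum_congr rfl fun b _ => ?_
    have h : ((‖sketch a f ω x b‖ ^ 2 : ℝ) : ℂ) =
        starRingEnd ℂ (sketch a f ω x b) * sketch a f ω x b := by
      rw [Complex.conj_mul']
      push_cast
      rfl
    have h' := congrArg Complex.re h
    rw [Complex.ofReal_re] at h'
    rw [h', sketch, map_sum, Finset.sum_mul_sum, Complex.re_sum]
    refine Finset.sum_congr rfl fun i _ => ?_
    rw [Complex.re_sum]
    refine Finset.sum_congr rfl fun j _ => ?_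
    rw [← Complex.re_ofReal_mul]
    congr 1
    rw [map_mul, Complex.conj_ofReal]
    push_cast
    ring
  have hoff : ∀ i j : J, i ≠ j →
      (𝔼 ω : J → E, (starRingEnd ℂ (f (ω i) x) * f (ω j) x).re) = 0 := by
    intro i j hij
    have hi : Function.Involutive (fun ω : J → E => Function.update ω j (neg (ω j))) := by
      intro ω
      simp [hinv _]
    have := Fintype.expect_equiv hi.toPerm
      (fun ω : J → E => -(starRingEnd ℂ (f (ω i) x) * f (ω j) x).re)
      (fun ω : J → E => (starRingEnd ℂ (f (ω i) x) * f (ω j) x).re) (fun ω => by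
        simp [Function.update_of_ne hij, hneg])
    rw [Finset.expect_neg_distrib] at this
    linarith
  have hdiag : ∀ i : J, (𝔼 ω : J → E, (starRingEnd ℂ (f (ω i) x) * f (ω i) x).re) =
      𝔼 e, ‖f e x‖ ^ 2 := by
    intro i
    rw [← expect_apply (fun e => ‖f e x‖ ^ 2) i]
    refine Finset.expect_congr rfl fun ω _ => ?_
    rw [Complex.conj_mul', ← Complex.ofReal_pow, Complex.ofReal_re]
  simp_rw [hexp]
  rw [Finset.expect_sum_comm, Finset.sum_mul]
  refine Finset.sum_congr rfl fun b _ => ?_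
  rw [Finset.expect_sum_comm, Finset.sum_mul]
  refine Finset.sum_congr rfl fun i _ => ?_
  rw [Finset.expect_sum_comm]
  simp_rw [← Finset.mul_expect]
  rw [Finset.sum_eq_single i (fun j _ hj => by rw [hoff i j hj.symm, mul_zero])
    (fun h => absurd (Finset.mem_univ i) h), hdiag]
  ring

/-- Sequential selection keeping an exponential potential small. -/
lemma exists_sum_exp_le {V Φ : Type*} [Fintype V] [Fintype Φ] (c : V → ℝ) (hc : ∀ v, 0 ≤ c v)
    (hc1 : ∑ v, c v = 1) (h : Φ → V → ℝ) (hmean : ∀ φ, ∑ v, c v * h φ v = 0) {B : ℝ} (hB : 0 < B)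
    (hh : ∀ φ v, |h φ v| ≤ B) (t : ℝ) (q : ℕ) :
    ∃ y : Fin q → V, ∑ φ, Real.exp (t * ∑ i, h φ (y i)) ≤
      Fintype.card Φ * Real.exp (q * ((t * B) ^ 2 / 2)) := by
  induction q with
  | zero => exact ⟨Fin.elim0, by simp⟩
  | succ q ih =>
    obtain ⟨y, hy⟩ := ih
    set P : Φ → ℝ := fun φ => Real.exp (t * ∑ i, h φ (y i)) with hP
    have hmgf : ∀ φ, ∑ v, c v * Real.exp (t * h φ v) ≤ Real.exp ((t * B) ^ 2 / 2) := by
      intro φ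
      calc _ ≤ ∑ v, c v * (Real.cosh (t * B) + h φ v / B * Real.sinh (t * B)) := by
            refine Finset.sum_le_sum fun v _ => mul_le_mul_of_nonneg_left ?_ (hc v)
            have := Real.exp_mul_le_cosh_add_mul_sinh (t := h φ v / B)
              (by rw [abs_div, abs_of_pos hB, div_le_one hB]; exact hh φ v) (t * B)
            rwa [show h φ v / B * (t * B) = t * h φ v by field_simp] at this
        _ = (∑ v, c v) * Real.cosh (t * B) +
            (∑ v, c v * h φ v) * (Real.sinh (t * B) / B) := by
            rw [Finset.sum_mul, Finset.sum_mul, ← Finset.sum_add_distrib]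
            refine Finset.sum_congr rfl fun v _ => ?_
            ring
        _ ≤ _ := by
            rw [hc1, hmean, one_mul, zero_mul, add_zero]
            exact Real.cosh_le_exp_half_sq _
    have havg : ∑ v, c v * ∑ φ, P φ * Real.exp (t * h φ v) ≤
        ∑ v, c v * ((∑ φ, P φ) * Real.exp ((t * B) ^ 2 / 2)) := by
      rw [← Finset.sum_mul, hc1, one_mul, Finset.sum_mul]
      simp_rw [Finset.mul_sum]
      rw [Finset.sum_comm]
      refine Finset.sum_le_sum fun φ _ => ?_
      calc _ = P φ * ∑ v, c v * Real.exp (t * h φ v) := by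
            rw [Finset.mul_sum]
            refine Finset.sum_congr rfl fun v _ => ?_
            ring
        _ ≤ _ := by
            have := hmgf φ
            gcongr
    obtain ⟨v, -, hcv, hv⟩ : ∃ v ∈ Finset.univ, 0 < c v ∧
        ∑ φ, P φ * Real.exp (t * h φ v) ≤ (∑ φ, P φ) * Real.exp ((t * B) ^ 2 / 2) := by
      by_contra! hcon
      have hex : ∃ v, 0 < c v := by
        by_contra! h0
        have : ∑ v, c v ≤ 0 := Finset.sum_nonpos fun v _ => h0 v
        linarith
      obtain ⟨v₀, hv₀⟩ := hex
      refine absurd havg (not_le.2 (Finset.sum_lt_sum (fun v hv => ?_) ⟨v₀, Finset.mem_univ _, ?_⟩))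
      · rcases (hc v).eq_or_lt with h0 | h0
        · simp [← h0]
        · exact mul_le_mul_of_nonneg_left (hcon v hv h0).le h0.le
      · exact mul_lt_mul_of_pos_left (hcon v₀ (Finset.mem_univ _) hv₀) hv₀
    refine ⟨Fin.cons v y, ?_⟩
    calc _ = ∑ φ, P φ * Real.exp (t * h φ v) := by
          refine Finset.sum_congr rfl fun φ _ => ?_
          rw [hP, ← Real.exp_add, Fin.sum_univ_succ]
          simp only [Fin.cons_zero, Fin.cons_succ]
          ring_nf
      _ ≤ Fintype.card Φ * Real.exp (q * ((t * B) ^ 2 / 2)) * Real.exp ((t * B) ^ 2 / 2) :=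
          hv.trans (by gcongr)
      _ = _ := by
          rw [mul_assoc, ← Real.exp_add]
          push_cast
          ring_nf

/-- Maurey's empirical approximation of a convex combination, uniformly over finitely many
complex functionals. -/
lemma exists_empirical_approx {V I X : Type*} [Fintype V] [Fintype I] [Nonempty I] [AddCommGroup X]
    [Module ℂ X] (f : I → X →ₗ[ℂ] ℂ) (P : V → X) (c : V → ℝ) (hc : ∀ v, 0 ≤ c v)
    (hc1 : ∑ v, c v = 1) {S : ℝ} (hS : 0 < S) (hP : ∀ i v, ‖f i (P v)‖ ≤ S) (q : ℕ) (hq : 0 < q) :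
    ∃ y : Fin q → V, ∀ i,
      ‖f i ((q : ℂ)⁻¹ • ∑ s, P (y s)) - f i (∑ v, (c v : ℂ) • P v)‖ ≤
        4 * S * √(2 * Real.log (4 * Fintype.card I) / q) := by
  set x := ∑ v, (c v : ℂ) • P v with hx
  have hfx : ∀ i, f i x = ∑ v, (c v : ℂ) * f i (P v) := by
    intro i
    simp [hx]
  have hxS : ∀ i, ‖f i x‖ ≤ S := by
    intro i
    rw [hfx]
    calc _ ≤ ∑ v, c v * S := by
          refine (norm_sum_le _ _).trans (Finset.sum_le_sum fun v _ => ?_)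
          rw [norm_mul, Complex.norm_real, Real.norm_of_nonneg (hc v)]
          exact mul_le_mul_of_nonneg_left (hP i v) (hc v)
      _ = S := by rw [← Finset.sum_mul, hc1, one_mul]
  let part : Bool → ℂ →ₗ[ℝ] ℝ := fun b => if b then Complex.reLm else Complex.imLm
  have hpart : ∀ b z, |part b z| ≤ ‖z‖ := by
    intro b z
    cases b
    · exact Complex.abs_im_le_norm z
    · exact Complex.abs_re_le_norm z
  let h : I × Bool × Bool → V → ℝ := fun φ v =>
    rsign φ.2.1 * part φ.2.2 (f φ.1 (P v) - f φ.1 x)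
  have hrs : ∀ b, |rsign b| = 1 := by intro b; cases b <;> simp [rsign]
  have hmean : ∀ φ, ∑ v, c v * h φ v = 0 := by
    rintro ⟨i, s, b⟩
    have e : ∑ v, c v * h (i, s, b) v =
        rsign s * part b (∑ v, (c v) • (f i (P v) - f i x)) := by
      rw [map_sum, Finset.mul_sum]
      refine Finset.sum_congr rfl fun v _ => ?_
      rw [map_smul, smul_eq_mul]
      simp only [h]
      ring
    have e2 : ∑ v, (c v) • (f i (P v) - f i x) = 0 := by
      simp_rw [smul_sub]
      rw [Finset.sum_sub_distrib, ← Finset.sum_smul, hc1, one_smul, hfx]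
      simp
    rw [e, e2, map_zero, mul_zero]
  have hbd : ∀ φ v, |h φ v| ≤ 2 * S := by
    rintro ⟨i, s, b⟩ v
    simp only [h]
    rw [abs_mul, hrs, one_mul]
    refine (hpart _ _).trans ((norm_sub_le _ _).trans ?_)
    linarith [hP i v, hxS i]
  set ℓ := Real.log (4 * Fintype.card I) with hℓ
  have hcardI : (1 : ℝ) ≤ Fintype.card I := by exact_mod_cast Fintype.card_pos
  have hℓ0 : 0 < ℓ := Real.log_pos (by linarith)
  have hq' : (0 : ℝ) < q := by exact_mod_cast hq
  set τ := √(2 * ℓ / q) with hτ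
  have hτ0 : 0 < τ := Real.sqrt_pos.2 (by positivity)
  have hτ2 : τ ^ 2 = 2 * ℓ / q := Real.sq_sqrt (by positivity)
  obtain ⟨y, hy⟩ := exists_sum_exp_le c hc hc1 h hmean (by positivity : 0 < 2 * S) hbd
    (τ / (2 * S)) q
  have hcardΦ : (Fintype.card (I × Bool × Bool) : ℝ) = Real.exp ℓ := by
    rw [hℓ, Real.exp_log (by linarith)]
    simp
    ring
  have hone : ∀ φ, ∑ s, h φ (y s) ≤ q * (2 * S * τ) := by
    intro φ
    have h1 := (Finset.single_le_sum
      (f := fun φ => Real.exp (τ / (2 * S) * ∑ s, h φ (y s)))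
      (fun φ _ => (Real.exp_pos _).le) (Finset.mem_univ φ)).trans hy
    rw [hcardΦ, ← Real.exp_add, Real.exp_le_exp, div_mul_cancel₀ _ (by positivity), hτ2] at h1
    have h2 : τ / (2 * S) * ∑ s, h φ (y s) ≤ q * τ ^ 2 := by
      refine h1.trans_eq ?_
      rw [hτ2]
      field_simp
      norm_num
    have h3 : τ * ∑ s, h φ (y s) ≤ τ * (q * (2 * S * τ)) := by
      rw [div_mul_eq_mul_div, div_le_iff₀ (by positivity)] at h2
      linarith
    exact le_of_mul_le_mul_left h3 hτ0
  refine ⟨y, fun i => ?_⟩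
  set z := ∑ s, (f i (P (y s)) - f i x) with hz
  have e : f i ((q : ℂ)⁻¹ • ∑ s, P (y s)) - f i x = (q : ℂ)⁻¹ * z := by
    rw [map_smul, map_sum, hz, Finset.sum_sub_distrib, smul_eq_mul, mul_sub]
    have hqc : (q : ℂ) ≠ 0 := by exact_mod_cast hq.ne'
    simp [hqc]
  have hzp : ∀ b, |part b z| ≤ q * (2 * S * τ) := by
    intro b
    have h1 : ∀ s, ∑ k, h (i, s, b) (y k) = rsign s * part b z := by
      intro s
      rw [hz, map_sum, Finset.mul_sum]
    have h2 := hone (i, true, b)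
    have h3 := hone (i, false, b)
    rw [h1] at h2 h3
    simp only [rsign] at h2 h3
    simp at h2 h3
    rw [abs_le]
    constructor <;> linarith
  have hnz : ‖z‖ ≤ q * (4 * S * τ) := by
    refine (Complex.norm_le_abs_re_add_abs_im z).trans ?_
    have h1 := hzp true
    have h2 := hzp false
    simp only [part] at h1 h2
    simp at h1 h2
    linarith
  rw [e, norm_mul, norm_inv, Complex.norm_natCast, inv_mul_le_iff₀ hq']
  exact hnz

/-- `x` has at most `k` nonzero entries and Euclidean norm at most one. -/
def IsSparseUnit {n : ℕ} (k : ℕ) (x : Fin n → ℂ) : Prop :=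
  ∑ j, ‖x j‖ ^ 2 ≤ 1 ∧ ∃ s : Finset (Fin n), s.card ≤ k ∧ ∀ t ∉ s, x t = 0

lemma IsSparseUnit.sum_abs_le {n k : ℕ} {x : Fin n → ℂ} (hx : IsSparseUnit k x) :
    ∑ j, (|(x j).re| + |(x j).im|) ≤ √(2 * k) := by
  obtain ⟨h1, s, hs, h0⟩ := hx
  have e : ∑ j, (|(x j).re| + |(x j).im|) = ∑ j ∈ s, (|(x j).re| + |(x j).im|) := by
    symm
    refine Finset.sum_subset (Finset.subset_univ s) fun j _ hj => ?_
    simp [h0 j hj]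
  rw [e]
  refine Real.le_sqrt_of_sq_le ?_
  refine (sq_sum_le_card_mul_sum_sq).trans ?_
  have hle : ∑ j ∈ s, (|(x j).re| + |(x j).im|) ^ 2 ≤ 2 := by
    calc _ ≤ ∑ j ∈ s, 2 * ‖x j‖ ^ 2 := by
          refine Finset.sum_le_sum fun j _ => ?_
          rw [← Complex.normSq_eq_norm_sq, Complex.normSq_apply]
          nlinarith [sq_abs (x j).re, sq_abs (x j).im, sq_nonneg (|(x j).re| - |(x j).im|)]
      _ ≤ ∑ j, 2 * ‖x j‖ ^ 2 :=
          Finset.sum_le_sum_of_subset_of_nonneg (Finset.subset_univ s) fun _ _ _ => by positivity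
      _ ≤ 2 := by rw [← Finset.mul_sum]; linarith
  have hs' : (s.card : ℝ) ≤ k := by exact_mod_cast hs
  have h0 : (0 : ℝ) ≤ k := by positivity
  calc _ ≤ (k : ℝ) * 2 := by gcongr
    _ = _ := by ring

/-- The vertices of the cross-polytope of radius `S` in `ℂ^n`, together with the origin. -/
def crossVertex {n : ℕ} (S : ℝ) : Option (Fin n × Bool × Bool) → Fin n → ℂ
  | none => 0
  | some (j, s, b) => Pi.single j (((S * rsign s : ℝ) : ℂ) * if b then 1 else Complex.I)

lemma exists_crossVertex_weights {n : ℕ} {S : ℝ} (hS : 0 < S) (x : Fin n → ℂ)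
    (hx : ∑ j, (|(x j).re| + |(x j).im|) ≤ S) :
    ∃ c : Option (Fin n × Bool × Bool) → ℝ, (∀ v, 0 ≤ c v) ∧ ∑ v, c v = 1 ∧
      ∑ v, (c v : ℂ) • crossVertex S v = x := by
  let w : Fin n × Bool × Bool → ℝ := fun z =>
    max (rsign z.2.1 * if z.2.2 then (x z.1).re else (x z.1).im) 0 / S
  have hw0 : ∀ z, 0 ≤ w z := fun z => div_nonneg (le_max_right _ _) hS.le
  have habs : ∀ t : ℝ, max t 0 + max (-t) 0 = |t| := by
    intro t
    rcases le_total 0 t with h | h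
    · simp [h, abs_of_nonneg h]
    · simp [h, abs_of_nonpos h]
  have hsub : ∀ t : ℝ, max t 0 - max (-t) 0 = t := by
    intro t
    rcases le_total 0 t with h | h
    · simp [h]
    · simp [h]
  have hsum : ∑ z, w z = (∑ j, (|(x j).re| + |(x j).im|)) / S := by
    rw [Finset.sum_div, Fintype.sum_prod_type]
    refine Finset.sum_congr rfl fun j _ => ?_
    simp only [Fintype.sum_prod_type, Fintype.sum_bool, w, rsign]
    have h1 := habs (x j).re
    have h2 := habs (x j).im
    simp
    linear_combination S⁻¹ * (h1 + h2)
  refine ⟨fun v => v.elim (1 - ∑ z, w z) w, ?_, ?_, ?_⟩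
  · rintro (_ | z)
    · simp only [Option.elim]
      rw [hsum]
      linarith [(div_le_one hS).2 hx]
    · exact hw0 z
  · rw [Fintype.sum_option]
    simp
  · rw [Fintype.sum_option]
    simp only [Option.elim, crossVertex, smul_zero, zero_add]
    rw [Fintype.sum_prod_type]
    have h : ∀ j, ∑ z : Bool × Bool, ((w (j, z) : ℝ) : ℂ) • (crossVertex S (some (j, z)) :
        Fin n → ℂ) = Pi.single j (x j) := by
      intro j
      have hSc : (S : ℂ) ≠ 0 := by exact_mod_cast hS.ne'
      have hre := hsub (x j).re
      have him := hsub (x j).im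
      simp only [Fintype.sum_prod_type, Fintype.sum_bool, crossVertex, ← Pi.single_smul,
        ← Pi.single_add]
      congr 1
      simp only [w, rsign, smul_eq_mul]
      apply Complex.ext
      · simp
        field_simp
        linarith
      · simp
        field_simp
        linarith
    calc _ = ∑ j, (Pi.single j (x j) : Fin n → ℂ) := Finset.sum_congr rfl fun j _ => h j
      _ = x := Finset.univ_sum_single x

/-- A finite set is approximated by its own elements, one for each cell of a coding map. -/
lemma exists_representatives {X C : Type*} [DecidableEq X] [Fintype C] (N : Finset X)
    (code : X → C) :
    ∃ π : X → X, (∀ x ∈ N, π x ∈ N ∧ code (π x) = code x) ∧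
      (N.image π).card ≤ Fintype.card C := by
  classical
  rcases N.eq_empty_or_nonempty with rfl | ⟨x₀, _⟩
  · exact ⟨id, by simp, by simp⟩
  let g : C → X := fun c => if h : ∃ y ∈ N, code y = c then h.choose else x₀
  refine ⟨fun x => g (code x), fun x hx => ?_, ?_⟩
  · have h : ∃ y ∈ N, code y = code x := ⟨x, hx, rfl⟩
    simp only [g, dif_pos h]
    exact h.choose_spec
  · calc _ ≤ (Finset.univ.image g).card := by
          refine Finset.card_le_card fun y hy => ?_
          obtain ⟨x, _, rfl⟩ := Finset.mem_image.1 hy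
          exact Finset.mem_image_of_mem g (Finset.mem_univ _)
      _ ≤ _ := Finset.card_image_le

/-- Coarse internal approximation of a set of sparse vectors with respect to finitely many
bounded functionals. -/
lemma exists_coarse_approx {n k : ℕ} (hn : 0 < n) (hk : 0 < k) (f : Fin n → (Fin n → ℂ) →ₗ[ℂ] ℂ)
    (hf : ∀ i j z, ‖f i (Pi.single j z)‖ ≤ ‖z‖) (N : Finset (Fin n → ℂ))
    (hN : ∀ x ∈ N, IsSparseUnit k x) (q : ℕ) (hq : 0 < q) {ε : ℝ}
    (hε : 8 * √(Real.log (4 * n) / q) ≤ ε) :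
    ∃ π : (Fin n → ℂ) → (Fin n → ℂ), (∀ x ∈ N, π x ∈ N) ∧
      (∀ x ∈ N, ∀ i, ‖f i (π x - x)‖ ≤ 2 * √k * ε) ∧ (N.image π).card ≤ (4 * n + 1) ^ q := by
  classical
  have : Nonempty (Fin n) := ⟨⟨0, hn⟩⟩
  have hk' : (0 : ℝ) < k := by exact_mod_cast hk
  have hS : 0 < √(2 * (k : ℝ)) := Real.sqrt_pos.2 (by positivity)
  have hv : ∀ i (v : Option (Fin n × Bool × Bool)),
      ‖f i (crossVertex √(2 * (k : ℝ)) v)‖ ≤ √(2 * (k : ℝ)) := by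
    rintro i (_ | ⟨j, s, b⟩)
    · simp [crossVertex]
    · refine (hf i j _).trans ?_
      cases s <;> cases b <;> simp [rsign, abs_of_nonneg]
  have hcode : ∀ x ∈ N, ∃ y : Fin q → Option (Fin n × Bool × Bool), ∀ i,
      ‖f i ((q : ℂ)⁻¹ • ∑ s, crossVertex √(2 * (k : ℝ)) (y s)) - f i x‖ ≤ √k * ε := by
    intro x hx
    obtain ⟨c, hc, hc1, hcx⟩ := exists_crossVertex_weights hS x (hN x hx).sum_abs_le
    obtain ⟨y, hy⟩ := exists_empirical_approx f (crossVertex √(2 * (k : ℝ))) c hc hc1 hS hv q hq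
    refine ⟨y, fun i => ?_⟩
    rw [hcx] at hy
    refine (hy i).trans ?_
    rw [Fintype.card_fin]
    calc _ = √k * (8 * √(Real.log (4 * n) / q)) := by
          rw [mul_div_assoc, Real.sqrt_mul (by norm_num) (k : ℝ),
            Real.sqrt_mul (by norm_num) (Real.log (4 * n) / q)]
          have : √(2 : ℝ) * √2 = 2 := Real.mul_self_sqrt (by norm_num)
          linear_combination (4 * √(k : ℝ) * √(Real.log (4 * n) / q)) * this
      _ ≤ _ := by gcongr
  choose! code hcode using hcode
  obtain ⟨π, hπ, hcard⟩ := exists_representatives N code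
  refine ⟨π, fun x hx => (hπ x hx).1, fun x hx i => ?_, hcard.trans_eq ?_⟩
  · obtain ⟨h1, h2⟩ := hπ x hx
    have b1 := hcode x hx i
    have b2 := hcode (π x) h1 i
    rw [h2] at b2
    rw [map_sub, norm_sub_rev]
    set m := f i ((q : ℂ)⁻¹ • ∑ s, crossVertex √(2 * (k : ℝ)) (code x s))
    calc ‖f i x - f i (π x)‖ = ‖(m - f i (π x)) - (m - f i x)‖ := by congr 1; ring
      _ ≤ ‖m - f i (π x)‖ + ‖m - f i x‖ := norm_sub_le _ _
      _ ≤ _ := by linarith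
  · simp
    ring

/-- Truncation of a real number towards zero. -/
lemma exists_int_trunc (T : ℝ) : ∃ m : ℤ, |(m : ℝ)| ≤ |T| ∧ |T - m| ≤ 1 := by
  rcases le_total 0 T with h | h
  · refine ⟨⌊T⌋, ?_, ?_⟩
    · have h0 : (0 : ℝ) ≤ ⌊T⌋ := by exact_mod_cast Int.floor_nonneg.2 h
      rw [abs_of_nonneg h0, abs_of_nonneg h]
      exact Int.floor_le T
    · rw [abs_le]
      constructor <;> linarith [Int.floor_le T, Int.lt_floor_add_one T]
  · refine ⟨⌈T⌉, ?_, ?_⟩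
    · have h0 : (⌈T⌉ : ℝ) ≤ 0 := by exact_mod_cast Int.ceil_le.2 (by simpa using h)
      rw [abs_of_nonpos h0, abs_of_nonpos h]
      linarith [Int.le_ceil T]
    · rw [abs_le]
      constructor <;> linarith [Int.le_ceil T, Int.ceil_lt_add_one T]

/-- The square grid of mesh `1 / M` in the complex square of half-width one. -/
def complexGrid (M : ℕ) : Finset ℂ :=
  (Finset.Icc (-(M : ℤ)) M ×ˢ Finset.Icc (-(M : ℤ)) M).image
    fun m => (⟨(m.1 : ℝ) / M, (m.2 : ℝ) / M⟩ : ℂ)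

lemma card_complexGrid_le (M : ℕ) : (complexGrid M).card ≤ (2 * M + 1) ^ 2 := by
  refine Finset.card_image_le.trans ?_
  rw [Finset.card_product, Int.card_Icc, ← pow_two]
  refine Nat.pow_le_pow_left ?_ 2
  omega

lemma exists_mem_complexGrid {M : ℕ} (hM : 0 < M) {z : ℂ} (hz : ‖z‖ ≤ 1) :
    ∃ w ∈ complexGrid M, ‖w‖ ≤ ‖z‖ ∧ ‖z - w‖ ^ 2 ≤ 2 / (M : ℝ) ^ 2 := by
  have hM' : (0 : ℝ) < M := by exact_mod_cast hM
  obtain ⟨a, ha, ha'⟩ := exists_int_trunc (M * z.re)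
  obtain ⟨b, hb, hb'⟩ := exists_int_trunc (M * z.im)
  rw [abs_mul, abs_of_pos hM'] at ha hb
  have hre := (Complex.abs_re_le_norm z).trans hz
  have him := (Complex.abs_im_le_norm z).trans hz
  have key : ∀ (t : ℝ) (m : ℤ), |t| ≤ 1 → |(m : ℝ)| ≤ M * |t| → m ∈ Finset.Icc (-(M : ℤ)) M := by
    intro t m ht hm
    have h : |(m : ℝ)| ≤ M := hm.trans (by nlinarith)
    rw [abs_le] at h
    rw [Finset.mem_Icc]
    exact ⟨by exact_mod_cast h.1, by exact_mod_cast h.2⟩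
  refine ⟨⟨(a : ℝ) / M, (b : ℝ) / M⟩, Finset.mem_image.2 ⟨(a, b), Finset.mem_product.2
    ⟨key _ _ hre ha, key _ _ him hb⟩, rfl⟩, ?_, ?_⟩
  · rw [← sq_le_sq₀ (norm_nonneg _) (norm_nonneg _), ← Complex.normSq_eq_norm_sq,
      ← Complex.normSq_eq_norm_sq, Complex.normSq_apply, Complex.normSq_apply]
    have h1 : ((a : ℝ) / M) ^ 2 ≤ z.re ^ 2 := by
      rw [sq_le_sq, abs_div, abs_of_pos hM', div_le_iff₀ hM']
      linarith
    have h2 : ((b : ℝ) / M) ^ 2 ≤ z.im ^ 2 := by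
      rw [sq_le_sq, abs_div, abs_of_pos hM', div_le_iff₀ hM']
      linarith
    simp only
    nlinarith
  · rw [← Complex.normSq_eq_norm_sq, Complex.normSq_apply, Complex.sub_re, Complex.sub_im]
    have h1 : z.re - a / M = (M * z.re - a) / M := by field_simp
    have h2 : z.im - b / M = (M * z.im - b) / M := by field_simp
    simp only
    rw [h1, h2, ← pow_two, ← pow_two, div_pow, div_pow, ← add_div]
    have h3 := (sq_le_one_iff_abs_le_one _).2 ha'
    have h4 := (sq_le_one_iff_abs_le_one _).2 hb'
    gcongr
    linarith

/-- A finite net for the sparse unit ball, respecting supports. -/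
lemma exists_sparse_net {n k : ℕ} (hn : 2 ≤ n) (hkn : k ≤ n) :
    ∃ N : Finset (Fin n → ℂ), (∀ x ∈ N, IsSparseUnit k x) ∧ N.card ≤ n ^ (13 * k) ∧
      ∀ x : Fin n → ℂ, IsSparseUnit k x → ∃ s : Finset (Fin n), s.card ≤ k ∧
        (∀ t ∉ s, x t = 0) ∧ ∃ y ∈ N, (∀ t ∉ s, y t = 0) ∧ ∑ j, ‖x j - y j‖ ^ 2 ≤ 1 / 16 := by
  classical
  let B : Finset (Fin n) → Finset (Fin n → ℂ) := fun s =>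
    Fintype.piFinset fun j => if j ∈ s then complexGrid (8 * n) else {0}
  have hB : ∀ s y, y ∈ B s → ∀ t ∉ s, y t = 0 := by
    intro s y hy t ht
    have := Fintype.mem_piFinset.1 hy t
    simpa [ht] using this
  refine ⟨((Finset.powersetCard k Finset.univ).biUnion B).filter fun y => ∑ j, ‖y j‖ ^ 2 ≤ 1,
    ?_, ?_, ?_⟩
  · intro x hx
    obtain ⟨hx, hx1⟩ := Finset.mem_filter.1 hx
    obtain ⟨s, hs, hxs⟩ := Finset.mem_biUnion.1 hx
    exact ⟨hx1, s, (Finset.mem_powersetCard.1 hs).2.le, hB s x hxs⟩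
  · refine (Finset.card_filter_le _ _).trans ?_
    have hgrid : (complexGrid (8 * n)).card ≤ n ^ 12 := by
      refine (card_complexGrid_le _).trans ?_
      have h6 : 2 * (8 * n) + 1 ≤ n ^ 6 := by
        have : 2 ^ 5 ≤ n ^ 5 := Nat.pow_le_pow_left hn 5
        nlinarith
      calc _ ≤ (n ^ 6) ^ 2 := Nat.pow_le_pow_left h6 2
        _ = _ := by rw [← pow_mul]
    have hcard : ∀ s ∈ Finset.powersetCard k (Finset.univ : Finset (Fin n)),
        (B s).card ≤ n ^ (12 * k) := by
      intro s hs
      have hsk := (Finset.mem_powersetCard.1 hs).2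
      rw [Fintype.card_piFinset]
      have : ∀ j, (if j ∈ s then complexGrid (8 * n) else {0}).card ≤ if j ∈ s then n ^ 12 else 1 := by
        intro j
        split_ifs
        · exact hgrid
        · simp
      calc _ ≤ ∏ j, if j ∈ s then n ^ 12 else 1 := Finset.prod_le_prod' fun j _ => this j
        _ = (n ^ 12) ^ s.card := by simp
        _ = _ := by rw [hsk, ← pow_mul]
    calc _ ≤ (Finset.powersetCard k (Finset.univ : Finset (Fin n))).card * n ^ (12 * k) :=
          Finset.card_biUnion_le_card_mul _ _ _ hcard
      _ ≤ n ^ k * n ^ (12 * k) := by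
          rw [Finset.card_powersetCard, Finset.card_univ, Fintype.card_fin]
          exact Nat.mul_le_mul_right _ (Nat.choose_le_pow n k)
      _ = _ := by rw [← pow_add]; ring_nf
  · rintro x ⟨hx1, s, hs, hxs⟩
    obtain ⟨s', hss', hs'⟩ := Finset.exists_superset_card_eq hs (by simpa using hkn)
    have hxn : ∀ j, ‖x j‖ ≤ 1 := by
      intro j
      have h : ‖x j‖ ^ 2 ≤ 1 := (Finset.single_le_sum (f := fun j => ‖x j‖ ^ 2)
        (fun i _ => by positivity) (Finset.mem_univ j)).trans hx1
      exact (sq_le_one_iff₀ (norm_nonneg _)).1 h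
    have hM : 0 < 8 * n := by omega
    choose w hw hwn hwd using fun j => exists_mem_complexGrid hM (hxn j)
    have hx0 : ∀ t ∉ s', x t = 0 := fun t ht => hxs t fun h => ht (hss' h)
    refine ⟨s', hs'.le, hx0, fun j => if j ∈ s' then w j else 0, ?_, ?_, ?_⟩
    · refine Finset.mem_filter.2 ⟨Finset.mem_biUnion.2 ⟨s', Finset.mem_powersetCard.2
        ⟨Finset.subset_univ _, hs'⟩, Fintype.mem_piFinset.2 fun j => ?_⟩, ?_⟩
      · split_ifs
        · exact hw j
        · simp
      · refine (Finset.sum_le_sum fun j _ => ?_).trans hx1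
        beta_reduce
        split_ifs
        · gcongr
          exact hwn j
        · simp
    · intro t ht
      simp [ht]
    · have hn' : (2 : ℝ) ≤ n := by exact_mod_cast hn
      calc _ ≤ ∑ _j : Fin n, 2 / ((8 * n : ℕ) : ℝ) ^ 2 := by
            refine Finset.sum_le_sum fun j _ => ?_
            beta_reduce
            split_ifs with h
            · exact hwd j
            · rw [hx0 j h, sub_zero, norm_zero, zero_pow two_ne_zero]
              positivity
        _ ≤ 1 / 16 := by
            simp only [Finset.sum_const, Finset.card_univ, Fintype.card_fin, nsmul_eq_mul]
            push_cast
            rw [mul_div_assoc', div_le_iff₀ (by positivity)]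
            nlinarith

lemma norm_apply_le_sum_abs {n : ℕ} (f : (Fin n → ℂ) →ₗ[ℂ] ℂ)
    (hf : ∀ j z, ‖f (Pi.single j z)‖ ≤ ‖z‖) (x : Fin n → ℂ) :
    ‖f x‖ ≤ ∑ j, (|(x j).re| + |(x j).im|) := by
  conv_lhs => rw [← Finset.univ_sum_single x, map_sum]
  refine (norm_sum_le _ _).trans (Finset.sum_le_sum fun j _ => (hf j _).trans ?_)
  exact Complex.norm_le_abs_re_add_abs_im _

lemma natCast_pow_eq_exp {n : ℕ} (hn : 0 < n) (q : ℕ) :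
    ((n : ℝ)) ^ q = Real.exp (q * Real.log n) := by
  rw [Real.exp_nat_mul, Real.exp_log (by exact_mod_cast hn)]

/-- Approximation of a finite set of sparse vectors at scale `2⁻ʳ`. -/
lemma exists_scale_approx {n k : ℕ} (hn : 2 ≤ n) (hk : 0 < k)
    (f : Fin n → (Fin n → ℂ) →ₗ[ℂ] ℂ) (hf : ∀ i j z, ‖f i (Pi.single j z)‖ ≤ ‖z‖)
    (N : Finset (Fin n → ℂ)) (hN : ∀ x ∈ N, IsSparseUnit k x) (r : ℕ) :
    ∃ π : (Fin n → ℂ) → (Fin n → ℂ), (r = 0 → ∀ x, π x = 0) ∧ (∀ x ∈ N, π x ∈ insert 0 N) ∧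
      (∀ x ∈ N, ∀ i, ‖f i (π x - x)‖ ≤ 2 * √k / 2 ^ r) ∧
      ((N.image π).card : ℝ) ≤ Real.exp (800 * 4 ^ r * Real.log n ^ 2) := by
  classical
  have hn' : (2 : ℝ) ≤ n := by exact_mod_cast hn
  have hl : 0.69 ≤ Real.log n :=
    (by linarith [Real.log_two_gt_d9] : (0.69 : ℝ) ≤ Real.log 2).trans
      (Real.log_le_log (by norm_num) hn')
  rcases Nat.eq_zero_or_pos r with rfl | hr
  · refine ⟨fun _ => 0, fun _ _ => rfl, fun x _ => Finset.mem_insert_self _ _, fun x hx i => ?_, ?_⟩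
    · rw [zero_sub, map_neg, norm_neg]
      refine (norm_apply_le_sum_abs (f i) (hf i) x).trans ((hN x hx).sum_abs_le.trans ?_)
      rw [Real.sqrt_mul (by norm_num), pow_zero, div_one]
      gcongr
      rw [Real.sqrt_le_left (by norm_num)]
      norm_num
    · have h1 : (N.image fun _ => (0 : Fin n → ℂ)).card ≤ 1 := by
        refine Finset.card_le_one.2 fun a ha b hb => ?_
        simp only [Finset.mem_image] at ha hb
        obtain ⟨_, _, rfl⟩ := ha
        obtain ⟨_, _, rfl⟩ := hb
        rfl
      calc ((N.image fun _ => (0 : Fin n → ℂ)).card : ℝ) ≤ 1 := by exact_mod_cast h1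
        _ ≤ _ := Real.one_le_exp (by positivity)
  · set l := Real.log n with hldef
    have h4r : (4 : ℝ) ≤ 4 ^ r := by
      calc (4 : ℝ) = 4 ^ 1 := by norm_num
        _ ≤ 4 ^ r := pow_le_pow_right₀ (by norm_num) hr
    have hpos : 0 < 192 * 4 ^ r * l := by positivity
    set q := ⌈192 * 4 ^ r * l⌉₊ with hq
    have hq0 : 0 < q := Nat.ceil_pos.2 hpos
    have hq1 : 192 * 4 ^ r * l ≤ q := Nat.le_ceil _
    have hq2 : (q : ℝ) ≤ 194 * 4 ^ r * l := by
      have := Nat.ceil_lt_add_one hpos.le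
      rw [← hq] at this
      nlinarith
    have hlog : Real.log (4 * n) ≤ 3 * l := by
      rw [Real.log_mul (by norm_num) (by positivity)]
      have : Real.log 4 ≤ 2 * l := by
        rw [show (4 : ℝ) = 2 ^ 2 by norm_num, Real.log_pow]
        have := Real.log_le_log (by norm_num) hn'
        push_cast
        linarith
      linarith
    have hε : 8 * √(Real.log (4 * n) / q) ≤ 1 / 2 ^ r := by
      have : √(Real.log (4 * n) / q) ≤ 1 / (8 * 2 ^ r) := by
        refine Real.sqrt_le_iff.2 ⟨by positivity, ?_⟩
        rw [div_le_iff₀ (by exact_mod_cast hq0)]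
        have e : (1 / (8 * 2 ^ r) : ℝ) ^ 2 = 1 / (64 * 4 ^ r) := by
          rw [div_pow, mul_pow, ← pow_mul, mul_comm r 2, pow_mul]
          norm_num
        rw [e]
        calc _ ≤ 3 * l := hlog
          _ = 1 / (64 * 4 ^ r) * (192 * 4 ^ r * l) := by field_simp; norm_num
          _ ≤ _ := by gcongr
      calc _ ≤ 8 * (1 / (8 * 2 ^ r) : ℝ) := by gcongr
        _ = _ := by field_simp
    obtain ⟨π, h1, h2, h3⟩ := exists_coarse_approx (by omega) hk f hf N hN q hq0 hε
    refine ⟨π, fun h => by omega, fun x hx => Finset.mem_insert_of_mem (h1 x hx), fun x hx i => ?_,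
      ?_⟩
    · refine (h2 x hx i).trans_eq ?_
      ring
    · have h4 : 4 * n + 1 ≤ n ^ 4 := by
        have : 2 ^ 3 ≤ n ^ 3 := Nat.pow_le_pow_left hn 3
        nlinarith
      calc ((N.image π).card : ℝ) ≤ (((4 * n + 1) ^ q : ℕ) : ℝ) := by exact_mod_cast h3
        _ ≤ (((n ^ 4) ^ q : ℕ) : ℝ) := by exact_mod_cast Nat.pow_le_pow_left h4 q
        _ = (n : ℝ) ^ (4 * q) := by push_cast; rw [pow_mul]
        _ = Real.exp ((4 * q : ℕ) * l) := natCast_pow_eq_exp (by omega) _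
        _ ≤ _ := by
          rw [Real.exp_le_exp]
          push_cast
          calc 4 * (q : ℝ) * l ≤ 4 * (194 * 4 ^ r * l) * l := by gcongr
            _ ≤ _ := by
              have : 0 ≤ 4 ^ r * l ^ 2 := by positivity
              nlinarith

/-- A chain of approximations of a finite set of sparse vectors, from the origin to the identity. -/
lemma exists_chain {n k : ℕ} (hn : 2 ≤ n) (hk : 0 < k) (hkn : k ≤ n)
    (f : Fin n → (Fin n → ℂ) →ₗ[ℂ] ℂ) (hf : ∀ i j z, ‖f i (Pi.single j z)‖ ≤ ‖z‖)
    (N : Finset (Fin n → ℂ)) (hN : ∀ x ∈ N, IsSparseUnit k x) (hcard : N.card ≤ n ^ (13 * k)) :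
    ∃ (R : ℕ) (π : ℕ → (Fin n → ℂ) → (Fin n → ℂ)) (η L : ℕ → ℝ),
      (∀ x ∈ N, π 0 x = 0) ∧ (∀ x ∈ N, π (R + 1) x = x) ∧
      (∀ r, ∀ x ∈ N, π r x ∈ insert 0 N) ∧ (∀ r, 0 ≤ η r) ∧ (∀ r, 0 ≤ L r) ∧
      (∀ r < R + 1, ∀ x ∈ N, ∀ i, ‖f i (π (r + 1) x - π r x)‖ ≤ η r) ∧
      (∀ r < R + 1, ((R : ℝ) + 1) * ((N.image fun x => (π r x, π (r + 1) x)).card : ℝ)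
        ≤ Real.exp (L r)) ∧
      ∑ r ∈ Finset.range (R + 1), η r * √(L r) ≤ 1000 * √k * Real.log n ^ 2 ∧
      ∑ r ∈ Finset.range (R + 1), η r ≤ 6 * √k := by
  classical
  have hn' : (2 : ℝ) ≤ n := by exact_mod_cast hn
  have hl2 : 0.69 ≤ Real.log 2 := by linarith [Real.log_two_gt_d9]
  have hl : 0.69 ≤ Real.log n := hl2.trans (Real.log_le_log (by norm_num) hn')
  choose ρ hρ0 hρN hρe hρc using fun r => exists_scale_approx hn hk f hf N hN r
  set l := Real.log n with hldef
  set R := Nat.log 2 n + 1 with hR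
  have hR1 : n < 2 ^ R := Nat.lt_pow_succ_log_self (by norm_num) n
  have hR2 : 2 ^ R ≤ 2 * n := by
    rw [hR, pow_succ, mul_comm]
    exact Nat.mul_le_mul_left 2 (Nat.pow_log_le_self 2 (by omega))
  have hRl : (R : ℝ) + 1 ≤ 5 * l := by
    have h : (2 : ℝ) ^ (Nat.log 2 n) ≤ n := by
      exact_mod_cast Nat.pow_log_le_self 2 (by omega : n ≠ 0)
    have h' := Real.log_le_log (by positivity) h
    rw [Real.log_pow] at h'
    have : ((Nat.log 2 n : ℕ) : ℝ) * 0.69 ≤ l := le_trans (by gcongr) h'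
    rw [hR]
    push_cast
    linarith
  have hRe : (R : ℝ) + 1 ≤ Real.exp (4 * l ^ 2) := by
    have h1 : R + 1 ≤ n ^ 2 := by
      have : R + 1 ≤ 2 ^ R := Nat.lt_two_pow_self
      nlinarith
    calc (R : ℝ) + 1 ≤ (n : ℝ) ^ 2 := by exact_mod_cast h1
      _ = Real.exp ((2 : ℕ) * l) := natCast_pow_eq_exp (by omega) 2
      _ ≤ _ := by
        rw [Real.exp_le_exp]
        push_cast
        nlinarith
  let π : ℕ → (Fin n → ℂ) → (Fin n → ℂ) := fun r => if r ≤ R then ρ r else id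
  have hπc : ∀ r ≤ R + 1, ((N.image (π r)).card : ℝ) ≤ Real.exp (800 * 4 ^ r * l ^ 2) := by
    intro r hr
    by_cases h : r ≤ R
    · simp only [π, if_pos h]
      exact hρc r
    · have hr' : r = R + 1 := by omega
      simp only [π, if_neg h, Finset.image_id]
      calc (N.card : ℝ) ≤ (n : ℝ) ^ (13 * k) := by exact_mod_cast hcard
        _ = Real.exp ((13 * k : ℕ) * l) := natCast_pow_eq_exp (by omega) _
        _ ≤ _ := by
          rw [Real.exp_le_exp]
          have hk2 : (k : ℝ) ≤ 4 ^ r := by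
            have : k ≤ 4 ^ r := by
              calc k ≤ 2 ^ R := by omega
                _ ≤ 4 ^ R := Nat.pow_le_pow_left (by norm_num) R
                _ ≤ 4 ^ r := Nat.pow_le_pow_right (by norm_num) (by omega)
            exact_mod_cast this
          push_cast
          calc 13 * (k : ℝ) * l ≤ 13 * 4 ^ r * l := by gcongr
            _ ≤ _ := by
              have h4 : (0 : ℝ) < 4 ^ r := by positivity
              have : 13 * l ≤ 800 * l ^ 2 := by nlinarith
              nlinarith
  have hπe : ∀ r, ∀ x ∈ N, ∀ i, ‖f i (π r x - x)‖ ≤ 2 * √k / 2 ^ r := by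
    intro r x hx i
    by_cases h : r ≤ R
    · simp only [π, if_pos h]
      exact hρe r x hx i
    · simp only [π, if_neg h, id, sub_self, map_zero, norm_zero]
      positivity
  have hsqrt : ∀ r : ℕ, √((65 * 2 ^ r * l) ^ 2) = 65 * 2 ^ r * l := fun r =>
    Real.sqrt_sq (by positivity)
  refine ⟨R, π, fun r => 3 * √k / 2 ^ r, fun r => (65 * 2 ^ r * l) ^ 2, ?_, ?_, ?_,
    fun r => by positivity, fun r => by positivity, ?_, ?_, ?_, ?_⟩
  · intro x _
    simp only [π, Nat.zero_le, if_true]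
    exact hρ0 0 rfl x
  · intro x _
    simp [π]
  · intro r x hx
    by_cases h : r ≤ R
    · simp only [π, if_pos h]
      exact hρN r x hx
    · simp only [π, if_neg h]
      exact Finset.mem_insert_of_mem hx
  · intro r _ x hx i
    have h1 := hπe r x hx i
    have h2 := hπe (r + 1) x hx i
    calc ‖f i (π (r + 1) x - π r x)‖ = ‖f i (π (r + 1) x - x) - f i (π r x - x)‖ := by
          rw [← map_sub]
          congr 2
          abel
      _ ≤ _ := norm_sub_le _ _
      _ ≤ 2 * √k / 2 ^ (r + 1) + 2 * √k / 2 ^ r := add_le_add h2 h1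
      _ = _ := by rw [pow_succ]; field_simp; norm_num
  · intro r hr
    have hc : (N.image fun x => (π r x, π (r + 1) x)).card
        ≤ (N.image (π r)).card * (N.image (π (r + 1))).card := by
      rw [← Finset.card_product]
      refine Finset.card_le_card fun z hz => ?_
      obtain ⟨x, hx, rfl⟩ := Finset.mem_image.1 hz
      exact Finset.mem_product.2 ⟨Finset.mem_image_of_mem _ hx, Finset.mem_image_of_mem _ hx⟩
    calc _ ≤ Real.exp (4 * l ^ 2) *
          (Real.exp (800 * 4 ^ r * l ^ 2) * Real.exp (800 * 4 ^ (r + 1) * l ^ 2)) := by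
          gcongr
          calc _ ≤ ((N.image (π r)).card : ℝ) * ((N.image (π (r + 1))).card : ℝ) := by
                exact_mod_cast hc
            _ ≤ _ := mul_le_mul (hπc r (by omega)) (hπc (r + 1) (by omega)) (by positivity)
                (by positivity)
      _ ≤ _ := by
          beta_reduce
          rw [← Real.exp_add, ← Real.exp_add, Real.exp_le_exp, mul_pow, mul_pow, ← pow_mul,
            mul_comm r 2, pow_mul]
          have h4 : (1 : ℝ) ≤ 4 ^ r := one_le_pow₀ (by norm_num)
          have hl0 : 0 ≤ l ^ 2 := by positivity
          rw [pow_succ (4 : ℝ) r]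
          norm_num
          nlinarith
  · calc _ = ∑ _r ∈ Finset.range (R + 1), 195 * √k * l := by
          refine Finset.sum_congr rfl fun r _ => ?_
          rw [hsqrt]
          field_simp
          norm_num
      _ = ((R : ℝ) + 1) * (195 * √k * l) := by simp
      _ ≤ 5 * l * (195 * √k * l) := by gcongr
      _ ≤ _ := by
          have : 0 ≤ √k * l ^ 2 := by positivity
          nlinarith
  · have hg : ∑ r ∈ Finset.range (R + 1), (1 / 2 : ℝ) ^ r ≤ 2 := sum_geometric_two_le (R + 1)
    calc _ = 3 * √k * ∑ r ∈ Finset.range (R + 1), (1 / 2 : ℝ) ^ r := by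
          rw [Finset.mul_sum]
          refine Finset.sum_congr rfl fun r _ => ?_
          rw [div_pow, one_pow]
          ring
      _ ≤ 3 * √k * 2 := by gcongr
      _ = _ := by ring

/-- Uniform concentration of the energy over a finite set, from a chaining bound. -/
lemma expect_ite_exists_energy_gt_le {J E β X : Type*} [Fintype J] [DecidableEq J] [Fintype E]
    [Nonempty E] [Fintype β] [AddCommGroup X] [Module ℂ X]
    (a : β → J → ℝ) (f : E → X →ₗ[ℂ] ℂ) {neg : E → E} (hinv : Function.Involutive neg)
    (hneg : ∀ e x, f (neg e) x = -f e x) (ha : ∑ b, ∑ j, a b j ^ 2 = 1) {ρ : ℝ} (hρ0 : 0 ≤ ρ)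
    (N : Finset X) (hne : N.Nonempty) (q : X → ℝ) (hq : ∀ x ∈ N, (𝔼 e, ‖f e x‖ ^ 2) = q x)
    (hq1 : ∀ x ∈ N, q x ≤ 1) {Γ d α ν : ℝ} {Q : (J → E) × (J → E) → ℝ} (hQ0 : ∀ w, 0 ≤ Q w)
    (hQ4 : (𝔼 w, Q w) ≤ 4)
    (hQ : ∀ w, ∀ S : ℝ, 0 ≤ S → (∀ y ∈ N, energy a f w.1 y + energy a f w.2 y ≤ S) →
        ∀ x ∈ N, |energy a f w.1 x - energy a f w.2 x| ≤
          2 * √(32 * ρ * S) * (Γ + d * √(Real.log (1 + Q w))))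
    (hα : 0 < α) (hα1 : α < 1) (hν : 0 < ν) (hg : 64 * ρ * Γ ^ 2 ≤ α ^ 2 / 2000)
    (hh : 64 * ρ * d ^ 2 * (4 + ν) ≤ α ^ 2 / 2000)
    [DecidablePred fun ω => ∃ x ∈ N, α < |energy a f ω x - q x|] :
    (𝔼 ω, if ∃ x ∈ N, α < |energy a f ω x - q x| then (1 : ℝ) else 0) ≤ Real.exp (-ν) := by
  classical
  set Z : (J → E) → ℝ := fun ω => N.sup' hne fun x => |energy a f ω x - q x| with hZ
  set D : (J → E) × (J → E) → ℝ := fun w =>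
    N.sup' hne fun x => |energy a f w.1 x - energy a f w.2 x| with hD
  have hZx : ∀ ω, ∀ x ∈ N, |energy a f ω x - q x| ≤ Z ω := fun ω x hx =>
    Finset.le_sup' (fun x => |energy a f ω x - q x|) hx
  have hDx : ∀ w, ∀ x ∈ N, |energy a f w.1 x - energy a f w.2 x| ≤ D w := fun w x hx =>
    Finset.le_sup' (fun x => |energy a f w.1 x - energy a f w.2 x|) hx
  have hZ0 : ∀ ω, 0 ≤ Z ω := fun ω =>
    (abs_nonneg _).trans (hZx ω _ hne.choose_spec)
  have hiff : ∀ ω, (∃ x ∈ N, α < |energy a f ω x - q x|) ↔ α < Z ω := fun ω => by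
    rw [hZ, Finset.lt_sup'_iff]
  have hE : ∀ x ∈ N, (𝔼 ω : J → E, energy a f ω x) = q x := fun x hx => by
    rw [expect_energy a f hinv hneg, ha, one_mul, hq x hx]
  simp only [hiff]
  refine expect_ite_gt_le_exp Z D Q (g := 64 * ρ * Γ ^ 2) (h := 64 * ρ * d ^ 2) hα hα1 hν
    (by positivity) hZ0 hQ0 hQ4 ?_ ?_ ?_ hg hh
  · intro ω
    refine Finset.sup'_le _ _ fun x hx => ?_
    have h : energy a f ω x - q x = 𝔼 ω' : J → E, (energy a f ω x - energy a f ω' x) := by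
      rw [Finset.expect_sub_distrib, Fintype.expect_const, hE x hx]
    rw [h]
    exact (Finset.abs_expect_le _ _).trans
      (Finset.expect_le_expect fun ω' _ => hDx (ω, ω') x hx)
  · intro ω ω'
    rw [sub_le_iff_le_add]
    refine Finset.sup'_le _ _ fun x hx => ?_
    have h1 := hDx (ω, ω') x hx
    have h2 := hZx ω' x hx
    simp only at h1
    calc _ = |(energy a f ω x - energy a f ω' x) + (energy a f ω' x - q x)| := by congr 1; ring
      _ ≤ _ := abs_add_le _ _
      _ ≤ _ := add_le_add h1 h2
  · intro w
    set S := 2 + Z w.1 + Z w.2 with hS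
    have hS0 : 0 ≤ S := by linarith [hZ0 w.1, hZ0 w.2]
    have hSy : ∀ y ∈ N, energy a f w.1 y + energy a f w.2 y ≤ S := by
      intro y hy
      have h1 := (abs_le.1 (hZx w.1 y hy)).2
      have h2 := (abs_le.1 (hZx w.2 y hy)).2
      linarith [hq1 y hy]
    refine Finset.sup'_le _ _ fun x hx => (hQ w S hS0 hSy x hx).trans ?_
    have hlog : 0 ≤ Real.log (1 + Q w) := Real.log_nonneg (by linarith [hQ0 w])
    set t := √(Real.log (1 + Q w)) with ht
    have ht2 : t ^ 2 = Real.log (1 + Q w) := Real.sq_sqrt hlog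
    rw [← ht2]
    set θ := α / 16 with hθ
    have hθ0 : 0 < θ := by positivity
    have hs : √(32 * ρ * S) ^ 2 = 32 * ρ * S := Real.sq_sqrt (by positivity)
    set s := √(32 * ρ * S)
    have h3 : (Γ + d * t) ^ 2 ≤ 2 * Γ ^ 2 + 2 * d ^ 2 * t ^ 2 := by
      nlinarith [sq_nonneg (Γ - d * t)]
    rw [← sub_le_iff_le_add', le_div_iff₀ hθ0]
    rcases hρ0.eq_or_lt with h0 | h0
    · have : s = 0 := by rw [← h0] at hs; simpa using hs
      have h4 : 0 ≤ θ * S * θ := by positivity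
      rw [this, ← h0]
      linarith
    · have h4 : (θ * s - 32 * ρ * (Γ + d * t)) ^ 2 ≥ 0 := sq_nonneg _
      have h5 : θ ^ 2 * s ^ 2 = θ ^ 2 * (32 * ρ * S) := by rw [hs]
      have h5 : 32 * ρ * ((2 * s * (Γ + d * t) - θ * S) * θ) ≤
          32 * ρ * (32 * ρ * (Γ + d * t) ^ 2) := by
        linarith
      have h6 := le_of_mul_le_mul_left h5 (by positivity)
      have h7 := mul_le_mul_of_nonneg_left h3 (by positivity : 0 ≤ 32 * ρ)
      linarith

lemma norm_sq_nine_sub_seven (a b : ℂ) :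
    ‖9 * a - 7 * b‖ ^ 2 - ‖7 * a - 9 * b‖ ^ 2 = 32 * (‖a‖ ^ 2 - ‖b‖ ^ 2) := by
  simp only [← Complex.normSq_eq_norm_sq, Complex.normSq_apply]
  simp
  ring

lemma norm_sq_nine_add_seven_le (a b : ℂ) :
    ‖9 * a - 7 * b‖ ^ 2 + ‖7 * a - 9 * b‖ ^ 2 ≤ 128 * ‖a - b‖ ^ 2 + 4 * (‖a‖ ^ 2 + ‖b‖ ^ 2) := by
  simp only [← Complex.normSq_eq_norm_sq, Complex.normSq_apply]
  simp
  nlinarith [sq_nonneg (a.re - b.re), sq_nonneg (a.im - b.im)]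

/-- A quadratic form is controlled on sparse vectors by its values on a net. -/
lemma abs_le_of_abs_le_on_net {n k : ℕ} (h : (Fin n → ℂ) → ℝ)
    (hsmul : ∀ (c : ℝ) x, h ((c : ℂ) • x) = c ^ 2 * h x)
    (hpar : ∀ x y, h ((9 : ℂ) • x - (7 : ℂ) • y) - h ((7 : ℂ) • x - (9 : ℂ) • y) = 32 * (h x - h y))
    (hbdd : ∃ B, ∀ x, IsSparseUnit k x → |h x| ≤ B) (N : Finset (Fin n → ℂ))
    (hNs : ∀ x ∈ N, IsSparseUnit k x)
    (hN : ∀ x : Fin n → ℂ, IsSparseUnit k x → ∃ s : Finset (Fin n), s.card ≤ k ∧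
        (∀ t ∉ s, x t = 0) ∧ ∃ y ∈ N, (∀ t ∉ s, y t = 0) ∧ ∑ j, ‖x j - y j‖ ^ 2 ≤ 1 / 16)
    {δ : ℝ} (hδ : ∀ y ∈ N, |h y| ≤ δ / 2) (x : Fin n → ℂ) (hx : IsSparseUnit k x) : |h x| ≤ δ := by
  obtain ⟨B, hB⟩ := hbdd
  set A : Set ℝ := {c | ∃ x, IsSparseUnit k x ∧ c = |h x|} with hA
  have hAb : BddAbove A := ⟨B, by rintro _ ⟨x, hx, rfl⟩; exact hB x hx⟩
  set M := sSup A with hM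
  have hxM : ∀ x, IsSparseUnit k x → |h x| ≤ M := fun x hx => le_csSup hAb ⟨x, hx, rfl⟩
  have hzero : h 0 = 0 := by simpa using hsmul 0 0
  have hscale : ∀ (s : Finset (Fin n)) (u : Fin n → ℂ), s.card ≤ k → (∀ t ∉ s, u t = 0) →
      |h u| ≤ M * ∑ j, ‖u j‖ ^ 2 := by
    intro s u hs hu
    set c := √(∑ j, ‖u j‖ ^ 2) with hc
    have hc2 : c ^ 2 = ∑ j, ‖u j‖ ^ 2 := Real.sq_sqrt (by positivity)
    have hc0 : 0 ≤ c := Real.sqrt_nonneg _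
    rcases hc0.eq_or_lt with h0 | h0
    · have hu0 : u = 0 := by
        rw [← h0, zero_pow two_ne_zero] at hc2
        funext j
        have := (Finset.sum_eq_zero_iff_of_nonneg fun j _ => by positivity).1 hc2.symm j
          (Finset.mem_univ j)
        simpa using this
      simp [hu0, hzero]
    · have hcc : (c : ℂ) ≠ 0 := by exact_mod_cast h0.ne'
      have e : u = (c : ℂ) • ((c⁻¹ : ℝ) : ℂ) • u := by
        rw [smul_smul]
        push_cast
        rw [mul_inv_cancel₀ hcc, one_smul]
      have hsp : IsSparseUnit k (((c⁻¹ : ℝ) : ℂ) • u) := by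
        refine ⟨?_, s, hs, fun t ht => by simp [hu t ht]⟩
        simp only [Pi.smul_apply, smul_eq_mul, norm_mul, mul_pow, Complex.norm_real]
        rw [← Finset.mul_sum, ← hc2, Real.norm_of_nonneg (by positivity), ← mul_pow,
          inv_mul_cancel₀ h0.ne', one_pow]
      rw [e, hsmul, abs_mul, abs_of_nonneg (sq_nonneg c), ← e, ← hc2, mul_comm]
      gcongr
      exact hxM _ hsp
  have hstep : ∀ x, IsSparseUnit k x → |h x| ≤ δ / 2 + M / 2 := by
    intro x hx
    obtain ⟨s, hs, hxs, y, hy, hys, hxy⟩ := hN x hx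
    have h1 := hscale s ((9 : ℂ) • x - (7 : ℂ) • y) hs (fun t ht => by simp [hxs t ht, hys t ht])
    have h2 := hscale s ((7 : ℂ) • x - (9 : ℂ) • y) hs (fun t ht => by simp [hxs t ht, hys t ht])
    have h3 : ∑ j, ‖((9 : ℂ) • x - (7 : ℂ) • y) j‖ ^ 2 + ∑ j, ‖((7 : ℂ) • x - (9 : ℂ) • y) j‖ ^ 2
        ≤ 16 := by
      rw [← Finset.sum_add_distrib]
      calc _ ≤ ∑ j, (128 * ‖x j - y j‖ ^ 2 + 4 * (‖x j‖ ^ 2 + ‖y j‖ ^ 2)) :=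
            Finset.sum_le_sum fun j _ => norm_sq_nine_add_seven_le (x j) (y j)
        _ = 128 * ∑ j, ‖x j - y j‖ ^ 2 + 4 * (∑ j, ‖x j‖ ^ 2 + ∑ j, ‖y j‖ ^ 2) := by
            rw [Finset.sum_add_distrib, ← Finset.mul_sum, ← Finset.mul_sum, Finset.sum_add_distrib]
        _ ≤ 16 := by linarith [hx.1, (hNs y hy).1]
    have hM0 : 0 ≤ M := (abs_nonneg _).trans (hxM x hx)
    have h4 : |32 * (h x - h y)| ≤ M * 16 := by
      rw [← hpar]
      calc _ ≤ |h ((9 : ℂ) • x - (7 : ℂ) • y)| + |h ((7 : ℂ) • x - (9 : ℂ) • y)| := abs_sub _ _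
        _ ≤ _ := add_le_add h1 h2
        _ ≤ _ := by rw [← mul_add]; gcongr
    rw [abs_mul, abs_of_pos (by norm_num : (0 : ℝ) < 32)] at h4
    calc |h x| = |(h x - h y) + h y| := by rw [sub_add_cancel]
      _ ≤ |h x - h y| + |h y| := abs_add_le _ _
      _ ≤ _ := by linarith [hδ y hy]
  have hMle : M ≤ δ / 2 + M / 2 := csSup_le ⟨_, x, hx, rfl⟩ (by
    rintro _ ⟨x, hx, rfl⟩
    exact hstep x hx)
  linarith [hxM x hx]

lemma energy_sub_abs_le_of_net {J E β : Type*} [Fintype J] [Fintype β] {n k : ℕ} (a : β → J → ℝ)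
    (f : E → (Fin n → ℂ) →ₗ[ℂ] ℂ) (hf : ∀ e j z, ‖f e (Pi.single j z)‖ ≤ ‖z‖) (ω : J → E)
    (N : Finset (Fin n → ℂ)) (hNs : ∀ x ∈ N, IsSparseUnit k x)
    (hN : ∀ x : Fin n → ℂ, IsSparseUnit k x → ∃ s : Finset (Fin n), s.card ≤ k ∧
        (∀ t ∉ s, x t = 0) ∧ ∃ y ∈ N, (∀ t ∉ s, y t = 0) ∧ ∑ j, ‖x j - y j‖ ^ 2 ≤ 1 / 16)
    {δ : ℝ} (hδ : ∀ y ∈ N, |energy a f ω y - ∑ j, ‖y j‖ ^ 2| ≤ δ / 2) (x : Fin n → ℂ)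
    (hx : IsSparseUnit k x) : |energy a f ω x - ∑ j, ‖x j‖ ^ 2| ≤ δ := by
  have hsk : ∀ (c : ℂ) x b, sketch a f ω (c • x) b = c * sketch a f ω x b := by
    intro c x b
    simp only [sketch, map_smul, smul_eq_mul, Finset.mul_sum]
    exact Finset.sum_congr rfl fun j _ => by ring
  refine abs_le_of_abs_le_on_net (fun x => energy a f ω x - ∑ j, ‖x j‖ ^ 2) ?_ ?_ ?_ N hNs hN hδ
    x hx
  · intro c x
    simp only [energy, hsk, Pi.smul_apply, smul_eq_mul, norm_mul, mul_pow, Complex.norm_real,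
      Real.norm_eq_abs, sq_abs]
    rw [← Finset.mul_sum, ← Finset.mul_sum, mul_sub]
  · intro x y
    simp only [energy, sketch_sub, hsk, Pi.sub_apply, Pi.smul_apply, smul_eq_mul]
    have h1 := Finset.sum_congr (rfl : (Finset.univ : Finset β) = _) fun b _ =>
      norm_sq_nine_sub_seven (sketch a f ω x b) (sketch a f ω y b)
    have h2 := Finset.sum_congr (rfl : (Finset.univ : Finset (Fin n)) = _) fun j _ =>
      norm_sq_nine_sub_seven (x j) (y j)
    rw [Finset.sum_sub_distrib, ← Finset.mul_sum, Finset.sum_sub_distrib] at h1 h2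
    linarith
  · refine ⟨∑ b, (∑ j, |a b j| * √(2 * k)) ^ 2 + 1, fun x hx => ?_⟩
    have h0 := energy_nonneg a f ω x
    have h1 : energy a f ω x ≤ ∑ b, (∑ j, |a b j| * √(2 * k)) ^ 2 := by
      refine Finset.sum_le_sum fun b _ => ?_
      gcongr
      refine (norm_sum_le _ _).trans (Finset.sum_le_sum fun j _ => ?_)
      rw [norm_mul, Complex.norm_real, Real.norm_eq_abs]
      gcongr
      exact (norm_apply_le_sum_abs _ (hf _) x).trans hx.sum_abs_le
    have h2 : 0 ≤ ∑ j, ‖x j‖ ^ 2 := by positivity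
    rw [abs_le]
    constructor <;> linarith [hx.1]

lemma norm2_sq {n : ℕ} (x : Fin n → ℝ) : norm2 x ^ 2 = ∑ j, x j ^ 2 :=
  Real.sq_sqrt (by positivity)

lemma norm2C_sq {n : ℕ} (x : Fin n → ℂ) : norm2C x ^ 2 = ∑ j, ‖x j‖ ^ 2 :=
  Real.sq_sqrt (by positivity)

lemma norm2_pos {n : ℕ} {x : Fin n → ℝ} (hx : x ≠ 0) : 0 < norm2 x := by
  obtain ⟨j, hj⟩ := Function.ne_iff.1 hx
  refine Real.sqrt_pos.2 (Finset.sum_pos' (fun i _ => sq_nonneg _) ⟨j, Finset.mem_univ j, ?_⟩)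
  have : x j ≠ 0 := hj
  positivity

lemma norm2_le_norm1 {n : ℕ} (x : Fin n → ℝ) : norm2 x ≤ norm1 x := by
  refine Real.sqrt_le_iff.2 ⟨Finset.sum_nonneg fun _ _ => abs_nonneg _, ?_⟩
  calc ∑ j, x j ^ 2 = ∑ j, |x j| ^ 2 := by simp only [sq_abs]
    _ ≤ _ := Finset.sum_sq_le_sq_sum_of_nonneg fun _ _ => abs_nonneg _

lemma kronRow_apply {p lam : ℕ} (v : Fin lam → ℝ) (b i : Fin p) (l : Fin lam) :
    kronRow p v b (finProdFinEquiv (i, l)) = if i = b then v l else 0 := by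
  have hlam : 0 < lam := Fin.pos l
  have h1 : ((finProdFinEquiv (i, l) : Fin (p * lam)) : ℕ) / lam = i := by
    rw [finProdFinEquiv_apply_val, Nat.add_mul_div_left _ _ hlam, Nat.div_eq_of_lt l.2, zero_add]
  have h2 : ((finProdFinEquiv (i, l) : Fin (p * lam)) : ℕ) % lam = l := by
    rw [finProdFinEquiv_apply_val, Nat.add_mul_mod_self_left, Nat.mod_eq_of_lt l.2]
  simp only [kronRow, Matrix.of_apply, h1, h2, Fin.ext_iff, l.2, dite_true]

lemma sum_kronRow_sq {p lam : ℕ} (v : Fin lam → ℝ) :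
    ∑ b, ∑ j, kronRow p v b j ^ 2 = p * norm2 v ^ 2 := by
  rw [norm2_sq]
  calc _ = ∑ _b : Fin p, ∑ l, v l ^ 2 := by
        refine Finset.sum_congr rfl fun b _ => ?_
        rw [← finProdFinEquiv.sum_comp, Fintype.sum_prod_type, Finset.sum_comm]
        refine Finset.sum_congr rfl fun l _ => ?_
        simp [kronRow_apply, ite_pow]
    _ = _ := by simp

lemma sum_norm_kronRow_mul_sq {p lam : ℕ} (v : Fin lam → ℝ) (S : Fin p → ℂ) :
    ∑ j, ‖∑ b, (kronRow p v b j : ℂ) * S b‖ ^ 2 = norm2 v ^ 2 * ∑ b, ‖S b‖ ^ 2 := by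
  rw [norm2_sq, ← finProdFinEquiv.sum_comp, Fintype.sum_prod_type, Finset.sum_comm,
    Finset.sum_mul_sum]
  refine Finset.sum_congr rfl fun l _ => Finset.sum_congr rfl fun i _ => ?_
  have : ∑ b, (kronRow p v b (finProdFinEquiv (i, l)) : ℂ) * S b = (v l : ℂ) * S i := by
    simp [kronRow_apply, apply_ite, ite_mul]
  rw [this, norm_mul, mul_pow, Complex.norm_real, Real.norm_eq_abs, sq_abs]

/-- The functional given by a row of `U`, with a sign. -/
def signedRow {n : ℕ} (U : Matrix (Fin n) (Fin n) ℂ) (e : Fin n × Bool) : (Fin n → ℂ) →ₗ[ℂ] ℂ :=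
  ((rsign e.2 : ℝ) : ℂ) • (LinearMap.proj e.1 ∘ₗ U.mulVecLin)

lemma signedRow_apply {n : ℕ} (U : Matrix (Fin n) (Fin n) ℂ) (e : Fin n × Bool) (x : Fin n → ℂ) :
    signedRow U e x = ((rsign e.2 : ℝ) : ℂ) * (U *ᵥ x) e.1 := rfl

lemma abs_rsign (b : Bool) : |rsign b| = 1 := by
  cases b <;> simp [rsign]

lemma norm_signedRow {n : ℕ} (U : Matrix (Fin n) (Fin n) ℂ) (e : Fin n × Bool) (x : Fin n → ℂ) :
    ‖signedRow U e x‖ = ‖(U *ᵥ x) e.1‖ := by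
  rw [signedRow_apply, norm_mul, Complex.norm_real, Real.norm_eq_abs, abs_rsign, one_mul]

lemma norm_signedRow_single_le {n : ℕ} {U : Matrix (Fin n) (Fin n) ℂ} (hU : ∀ i j, ‖U i j‖ ≤ 1)
    (e : Fin n × Bool) (j : Fin n) (z : ℂ) : ‖signedRow U e (Pi.single j z)‖ ≤ ‖z‖ := by
  rw [norm_signedRow, Matrix.mulVec_single]
  simp only [Pi.smul_apply, Matrix.col_apply, MulOpposite.smul_eq_mul_unop, MulOpposite.unop_op,
    norm_mul]
  exact mul_le_of_le_one_left (norm_nonneg _) (hU _ _)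

lemma signedRow_not {n : ℕ} (U : Matrix (Fin n) (Fin n) ℂ) (e : Fin n × Bool) (x : Fin n → ℂ) :
    signedRow U (e.1, !e.2) x = -signedRow U e x := by
  rcases e with ⟨i, b⟩
  cases b <;> simp [signedRow_apply, rsign]

lemma expect_norm_signedRow_sq {n : ℕ} (hn : 0 < n) {U : Matrix (Fin n) (Fin n) ℂ}
    (hU : Uᴴ * U = (n : ℂ) • (1 : Matrix (Fin n) (Fin n) ℂ)) (x : Fin n → ℂ) :
    (𝔼 e, ‖signedRow U e x‖ ^ 2) = ∑ j, ‖x j‖ ^ 2 := by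
  have hn' : (n : ℝ) ≠ 0 := by positivity
  have hsum : ∑ i, ‖(U *ᵥ x) i‖ ^ 2 = n * ∑ j, ‖x j‖ ^ 2 := by
    have hdot : ∀ y : Fin n → ℂ, ((∑ i, ‖y i‖ ^ 2 : ℝ) : ℂ) = star y ⬝ᵥ y := by
      intro y
      simp only [dotProduct, Pi.star_apply, RCLike.star_def, Complex.conj_mul']
      push_cast
      rfl
    have : ((∑ i, ‖(U *ᵥ x) i‖ ^ 2 : ℝ) : ℂ) = ((n * ∑ j, ‖x j‖ ^ 2 : ℝ) : ℂ) := by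
      rw [Complex.ofReal_mul, hdot, hdot, Matrix.star_mulVec, ← Matrix.dotProduct_mulVec,
        Matrix.mulVec_mulVec, hU, Matrix.smul_mulVec, Matrix.one_mulVec, dotProduct_smul,
        smul_eq_mul, Complex.ofReal_natCast]
    exact_mod_cast this
  rw [Fintype.expect_eq_sum_div_card, Fintype.sum_prod_type]
  simp only [norm_signedRow, Fintype.sum_bool, ← two_mul, ← Finset.mul_sum, Fintype.card_prod,
    Fintype.card_fin, Fintype.card_bool]
  rw [hsum]
  push_cast
  field_simp

lemma norm2C_mulVec_sq_eq_energy {n p m : ℕ} (A : Matrix (Fin p) (Fin m) ℝ)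
    (U : Matrix (Fin n) (Fin n) ℂ) (ω : Fin m → Fin n × Bool) (x : Fin n → ℂ) :
    norm2C ((A.map Complex.ofReal *
      Matrix.of fun j t => ((rsign (ω j).2 : ℝ) : ℂ) * U (ω j).1 t).mulVec x) ^ 2 =
      energy A (signedRow U) ω x := by
  rw [norm2C_sq]
  unfold energy
  refine Finset.sum_congr rfl fun b _ => ?_
  congr 2
  rw [← Matrix.mulVec_mulVec]
  change _ = ∑ j, (A b j : ℂ) * signedRow U (ω j) x
  simp only [Matrix.mulVec, dotProduct, Matrix.map_apply, Matrix.of_apply, signedRow_apply,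
    Finset.mul_sum, mul_assoc]

/-- Uniform concentration over a net of sparse vectors, for the sketched ensemble. -/
lemma exists_net_expect_ite_le {n k p lam : ℕ} {α ν : ℝ} {v : Fin lam → ℝ}
    {U : Matrix (Fin n) (Fin n) ℂ} (hn : 2 ≤ n) (hk : 0 < k) (hkn : k ≤ n) (hp : 0 < p)
    (hα : 0 < α) (hα1 : α < 1) (hν : 0 < ν)
    (hU : Uᴴ * U = (n : ℂ) • (1 : Matrix (Fin n) (Fin n) ℂ)) (hU1 : ∀ i j, ‖U i j‖ ≤ 1)
    (hv : v ≠ 0) (hpk : 10 ^ 12 * (k : ℝ) * (Real.log n ^ 4 + ν) / α ^ 2 ≤ p) :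
    ∃ N : Finset (Fin n → ℂ), (∀ x ∈ N, IsSparseUnit k x) ∧
      (∀ x : Fin n → ℂ, IsSparseUnit k x → ∃ s : Finset (Fin n), s.card ≤ k ∧
        (∀ t ∉ s, x t = 0) ∧ ∃ y ∈ N, (∀ t ∉ s, y t = 0) ∧ ∑ j, ‖x j - y j‖ ^ 2 ≤ 1 / 16) ∧
      ∀ P : (Fin (p * lam) → Fin n × Bool) → Prop, ∀ [DecidablePred P],
        (∀ ω, P ω → ∃ x ∈ N, α / 2 <
          |energy ((1 / (norm2 v * √p)) • kronRow p v) (signedRow U) ω x - ∑ j, ‖x j‖ ^ 2|) →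
        (𝔼 ω, if P ω then (1 : ℝ) else 0) ≤ Real.exp (-ν) := by
  classical
  have : Nonempty (Fin n) := ⟨⟨0, by omega⟩⟩
  obtain ⟨N, hNs, hNc, hN⟩ := exists_sparse_net hn hkn
  refine ⟨N, hNs, hN, fun P _ hP => ?_⟩
  have hne : N.Nonempty := by
    obtain ⟨_, _, _, y, hy, _⟩ := hN 0 ⟨by simp, ∅, by simp, by simp⟩
    exact ⟨y, hy⟩
  have hv2 := norm2_pos hv
  have hp' : (0 : ℝ) < p := by exact_mod_cast hp
  have hk' : (0 : ℝ) < k := by exact_mod_cast hk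
  have hn' : (2 : ℝ) ≤ n := by exact_mod_cast hn
  have hl : 0.69 ≤ Real.log n :=
    (by linarith [Real.log_two_gt_d9] : (0.69 : ℝ) ≤ Real.log 2).trans
      (Real.log_le_log (by norm_num) hn')
  set c := 1 / (norm2 v * √p) with hc
  have hc2 : c ^ 2 * norm2 v ^ 2 = 1 / p := by
    rw [hc, div_pow, mul_pow, Real.sq_sqrt hp'.le]
    field_simp
  set a : Matrix (Fin p) (Fin (p * lam)) ℝ := c • kronRow p v with ha
  have ha1 : ∑ b, ∑ j, a b j ^ 2 = 1 := by
    simp only [ha, Matrix.smul_apply, smul_eq_mul, mul_pow, ← Finset.mul_sum]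
    rw [sum_kronRow_sq, mul_left_comm, hc2]
    field_simp
  have hρ : ∀ S : Fin p → ℂ, ∑ j, ‖∑ b, (a b j : ℂ) * S b‖ ^ 2 ≤ 1 / (p : ℝ) * ∑ b, ‖S b‖ ^ 2 := by
    intro S
    refine le_of_eq ?_
    simp only [ha, Matrix.smul_apply, smul_eq_mul, Complex.ofReal_mul, mul_assoc,
      ← Finset.mul_sum, norm_mul, mul_pow, Complex.norm_real, Real.norm_eq_abs, sq_abs]
    rw [sum_norm_kronRow_mul_sq, ← mul_assoc, hc2]
  have hinv : Function.Involutive fun e : Fin n × Bool => (e.1, !e.2) := fun e => by simp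
  obtain ⟨R, π, η, L, hπ0, hπR, hπ, hη0, hL0, hη, hcard, hΓ, hd⟩ :=
    exists_chain hn hk hkn (fun i => signedRow U (i, true))
      (fun i => norm_signedRow_single_le hU1 (i, true)) N hNs hNc
  obtain ⟨Q, hQ0, hQ4, hQ⟩ := exists_energy_sub_le a (signedRow U) hinv (signedRow_not U) hρ
    (by positivity) N R π η L _ _ hπ0 hπR hπ hη0 hL0
    (fun r hr x hx e => by
      have := hη r hr x hx e.1
      rwa [norm_signedRow] at this ⊢) hcard hΓ hd
  have hkp : 10 ^ 12 * (k : ℝ) * (Real.log n ^ 4 + ν) ≤ p * α ^ 2 :=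
    (div_le_iff₀ (by positivity)).1 hpk
  have hsk : √(k : ℝ) ^ 2 = k := Real.sq_sqrt hk'.le
  have hl4 : 4 ≤ 18 * Real.log n ^ 4 := by
    have : (0.69 : ℝ) ^ 4 ≤ Real.log n ^ 4 := pow_le_pow_left₀ (by norm_num) hl 4
    norm_num at this ⊢
    linarith
  have hkl : 0 ≤ (k : ℝ) * Real.log n ^ 4 := by positivity
  have hkν : 0 ≤ (k : ℝ) * ν := by positivity
  refine le_trans (Finset.expect_le_expect fun ω _ => ?_)
    (expect_ite_exists_energy_gt_le a (signedRow U) hinv (signedRow_not U) ha1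
      (ρ := 1 / (p : ℝ)) (by positivity) N hne (fun x => ∑ j, ‖x j‖ ^ 2)
      (fun x _ => expect_norm_signedRow_sq (by omega) hU x) (fun x hx => (hNs x hx).1) hQ0 hQ4 hQ
      (α := α / 2) (by positivity) (by linarith) hν ?_ ?_)
  · split_ifs with h1 h2 h2
    · exact le_rfl
    · exact absurd (hP ω h1) h2
    · exact zero_le_one
    · exact le_rfl
  · rw [mul_pow, mul_pow, hsk, ← pow_mul, mul_one_div, div_mul_eq_mul_div, div_le_iff₀ hp']
    norm_num
    linarith
  · rw [mul_pow, hsk, mul_one_div, div_mul_eq_mul_div, div_mul_eq_mul_div, div_le_iff₀ hp']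
    have : (k : ℝ) * 4 ≤ k * (18 * Real.log n ^ 4) := by gcongr
    linarith

/-- high-probability restricted isometry property
`P( sup_{x ∈ T_k} | ‖V̂Φx‖₂² − ‖x‖₂² | ≤ α ) ≥ 1 − e^{−ν}` for `Φ` from
the sign-randomized bounded orthogonal ensemble, provided
`m ≥ p ≥ C₂ k (log⁴ n + γ²ν)/α²` with `γ = ‖v‖₁/‖v‖₂`. -/
theorem stmt14 :
    ∃ C₂ : ℝ, 0 < C₂ ∧
      ∀ (n k p lam : ℕ) (α ν γ : ℝ) (v : Fin lam → ℝ) (U : Matrix (Fin n) (Fin n) ℂ),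
        2 ≤ n → 0 < k → k ≤ n → 0 < p → 0 < lam →
        0 < α → α < 1 → 0 < ν →
        Uᴴ * U = (n : ℂ) • (1 : Matrix (Fin n) (Fin n) ℂ) →
        (∀ i j, ‖U i j‖ ≤ 1) →
        v ≠ 0 →
        γ = norm1 v / norm2 v →
        p ≤ p * lam →
        C₂ * (k : ℝ) * ((Real.log n) ^ 4 + γ ^ 2 * ν) / α ^ 2 ≤ (p : ℝ) →
        unifProb (fun ω : (Fin (p * lam) → Fin n) × (Fin (p * lam) → Bool) =>
            sSup {c : ℝ | ∃ x ∈ Tk n k,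
              c = |(norm2C (((((1 / (norm2 v * Real.sqrt p)) • kronRow p v).map Complex.ofReal) *
                      Matrix.of fun j t => ((rsign (ω.2 j) : ℝ) : ℂ) * U (ω.1 j) t).mulVec x)) ^ 2
                    - (norm2C x) ^ 2|} ≤ α)
          ≥ 1 - Real.exp (-ν) := by
  classical
  refine ⟨10 ^ 12, by norm_num, ?_⟩
  intro n k p lam α ν γ v U hn hk hkn hp _ hα hα1 hν hU hU1 hv hγ _ hpk
  have : Nonempty (Fin n) := ⟨⟨0, by omega⟩⟩
  have hγ1 : 1 ≤ γ ^ 2 := by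
    rw [hγ]
    exact one_le_pow₀ ((one_le_div (norm2_pos hv)).2 (norm2_le_norm1 v))
  have hpk' : 10 ^ 12 * (k : ℝ) * (Real.log n ^ 4 + ν) / α ^ 2 ≤ p := by
    refine le_trans ?_ hpk
    gcongr
    exact le_mul_of_one_le_left hν.le hγ1
  obtain ⟨N, hNs, hN, hbad⟩ :=
    exists_net_expect_ite_le (lam := lam) hn hk hkn hp hα hα1 hν hU hU1 hv hpk'
  set P : (Fin (p * lam) → Fin n) × (Fin (p * lam) → Bool) → Prop := fun ω =>
    sSup {c : ℝ | ∃ x ∈ Tk n k,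
      c = |(norm2C (((((1 / (norm2 v * Real.sqrt p)) • kronRow p v).map Complex.ofReal) *
              Matrix.of fun j t => ((rsign (ω.2 j) : ℝ) : ℂ) * U (ω.1 j) t).mulVec x)) ^ 2
            - (norm2C x) ^ 2|} ≤ α with hPdef
  let e : (Fin (p * lam) → Fin n × Bool) ≃ (Fin (p * lam) → Fin n) × (Fin (p * lam) → Bool) :=
    Equiv.arrowProdEquivProdArrow _ _ _
  have hgood : ∀ ω : Fin (p * lam) → Fin n × Bool, ¬ P (e ω) → ∃ x ∈ N, α / 2 <
      |energy ((1 / (norm2 v * √p)) • kronRow p v) (signedRow U) ω x - ∑ j, ‖x j‖ ^ 2| := by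
    intro ω hω
    by_contra hcon
    push Not at hcon
    refine hω (Real.sSup_le ?_ hα.le)
    rintro _ ⟨x, hx, rfl⟩
    have hx1 : ∑ j, ‖x j‖ ^ 2 = 1 := by rw [← norm2C_sq, hx.1, one_pow]
    have hmain := energy_sub_abs_le_of_net ((1 / (norm2 v * √p)) • kronRow p v) (signedRow U)
      (norm_signedRow_single_le hU1) ω N hNs hN hcon x ⟨hx1.le, hx.2⟩
    rw [← norm2C_mulVec_sq_eq_energy, ← norm2C_sq] at hmain
    exact hmain
  have hE := hbad (fun ω => ¬ P (e ω)) hgood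
  have hsum : unifProb P = 1 - 𝔼 ω : Fin (p * lam) → Fin n × Bool,
      if ¬ P (e ω) then (1 : ℝ) else 0 := by
    rw [unifProb_eq_expect, ← Fintype.expect_equiv e (fun ω => if P (e ω) then (1 : ℝ) else 0)
      (fun ω => if P ω then (1 : ℝ) else 0) fun _ => rfl, eq_sub_iff_add_eq,
      ← Finset.expect_add_distrib]
    refine (Finset.expect_congr rfl fun ω _ => ?_).trans (Fintype.expect_const 1)
    by_cases h : P (e ω) <;> simp [h]
  rw [hsum]
  linarith
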